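/- arXiv:1711.03839 — 2 statements merged into one kernel-verified Lean document; each statement's English description precedes it below -/
import Mathlib

section
/- Suppose each f_i is uniformly bounded and there exists V̄ : ℝ≥0 × 𝒳 → ℝ≥0 continuously differentiable with φ₁(|ξ|) ≤ V̄(t,ξ) ≤ φ₂(|ξ|) for φ₁, φ₂ ∈ 𝒦 and ∂V̄/∂t(t,ξ) + ∂V̄/∂ξ(t,ξ)·f_i(t,ξ) ≤ −η_i(t,ξ) for all t ≥ 0, ξ ∈ 𝒳 and i ∈ I, where each η_i : ℝ≥0 × 𝒳 → ℝ≥0 is measurable in t and continuous in ξ. Define h(t,ξ,i) := η_i(t,ξ) and suppose each h_i is uniformly bounded, measurable in t, continuous in ξ uniformly in t, precompact, and f_i = f̂_i + Δf_i with f̂_i uniformly bounded, measurable in t, continuous in ξ uniformly in t, precompact, and (h_i, Δf_i) a zeroing pair. Then the switched system ẋ = f(t,x,σ(t)) is UAS under arbitrary switchings provided that for each γ ∈ Λ, every bounded complete trajectory (x,u) of the system x′(t) = Σ_i u_i(t) f̂_{i,γ}(t,x(t)) with Σ_i u_i(t)|h_{i,γ}(t,x(t))| = 0 a.e. and u ∈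 𝒰 satisfies inf_{t∈ℝ}|x(t)| = 0. If, in addition, 𝒳 = ℝ^n and φ₁, φ₂ ∈ 𝒦∞, the system is GUAS under arbitrary switchings. -/
open MeasureTheory Filter Set Topology

noncomputable section

namespace SwitchedSys

/-- Euclidean state space ℝⁿ. -/
abbrev E (n : ℕ) := EuclideanSpace ℝ (Fin n)

/-! ### Comparison function classes -/

/-- Class 𝒦 functions (on [0,∞)). -/
def ClassK (α : ℝ → ℝ) : Prop :=
  ContinuousOn α (Ici 0) ∧ StrictMonoOn α (Ici 0) ∧ α 0 = 0

/-- Class 𝒦∞ functions. -/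
def ClassKInf (α : ℝ → ℝ) : Prop :=
  ClassK α ∧ Tendsto α atTop atTop

/-- Class 𝒦ℒ functions. -/
def ClassKL (β : ℝ → ℝ → ℝ) : Prop :=
  (∀ t, 0 ≤ t → ClassKInf fun r => β r t) ∧
  ∀ r, 0 ≤ r → AntitoneOn (fun t => β r t) (Ici 0) ∧
    Tendsto (fun t => β r t) atTop (nhds 0)

/-! ### Switching signals, controls and weak convergence -/

/-- A switching signal: piecewise constant and continuous from the right, with at most
finitely many jumps in each compact interval. -/
def IsSwitchingSignal {N : ℕ} (σ : ℝ → Fin N) : Prop :=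
  ∀ a b : ℝ, a < b → ∃ (k : ℕ) (τ : ℕ → ℝ), τ 0 = a ∧ τ k = b ∧
    (∀ j, j < k → τ j < τ (j + 1)) ∧
    ∀ j, j < k → ∀ s ∈ Ico (τ j) (τ (j + 1)), σ s = σ (τ j)

/-- The standard simplex U ⊆ ℝᴺ. -/
def simplexU (N : ℕ) : Set (Fin N → ℝ) := {μ | (∀ i, 0 ≤ μ i) ∧ ∑ i, μ i = 1}

/-- The set 𝒰 of admissible controls: measurable functions with values in the simplex. -/
def IsControl {N : ℕ} (u : ℝ → Fin N → ℝ) : Prop :=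
  Measurable u ∧ ∀ t, u t ∈ simplexU N

/-- The i-th canonical basis vector of ℝᴺ. -/
def stdVec (N : ℕ) (i : Fin N) : Fin N → ℝ := fun j => if j = i then 1 else 0

/-- The control u_σ = e_{σ(·)} associated with a switching signal σ. -/
def ctrlOfSwitch {N : ℕ} (σ : ℝ → Fin N) : ℝ → Fin N → ℝ := fun t => stdVec N (σ t)

/-- Weak convergence u_k ⇀ v, tested against all f ∈ L¹(ℝ,ℝᴺ). -/
def WeakConv {N : ℕ} (u : ℕ → ℝ → Fin N → ℝ) (v : ℝ → Fin N → ℝ) : Prop :=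
  ∀ g : ℝ → Fin N → ℝ, Integrable g volume →
    Tendsto (fun k => ∫ t : ℝ, ∑ i, g t i * u k t i)
      atTop (nhds (∫ t : ℝ, ∑ i, g t i * v t i))

/-! ### Regularity notions for time-varying maps -/

/-- g(t,ξ) is uniformly bounded: bounded on J′ × K for each compact K ⊆ 𝒳,
where J′ ⊆ [0,∞) has full measure. -/
def UnifBounded {X F : Type*} [TopologicalSpace X] [NormedAddCommGroup F]
    (𝒳 : Set X) (g : ℝ → X → F) : Prop :=
  ∃ J' ⊆ Ici (0:ℝ), volume (Ici (0:ℝ) \ J') = 0 ∧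
    ∀ K : Set X, IsCompact K → K ⊆ 𝒳 → ∃ C : ℝ, ∀ t ∈ J', ∀ ξ ∈ K, ‖g t ξ‖ ≤ C

/-- g(t,ξ) is continuous in ξ uniformly in t (via a class 𝒦 modulus of continuity on
each compact subset of 𝒳). -/
def ContXiUnifT {X F : Type*} [NormedAddCommGroup X] [NormedAddCommGroup F]
    (𝒳 : Set X) (g : ℝ → X → F) : Prop :=
  ∃ J' ⊆ Ici (0:ℝ), volume (Ici (0:ℝ) \ J') = 0 ∧
    ∀ K : Set X, IsCompact K → K ⊆ 𝒳 → ∃ ω : ℝ → ℝ, ClassK ω ∧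
      ∀ t ∈ J', ∀ ξ ∈ K, ∀ ζ ∈ K, ‖g t ξ - g t ζ‖ ≤ ω ‖ξ - ζ‖

/-- g(t,ξ) is locally Lipschitz in ξ uniformly in t. -/
def LipXiUnifT {X F : Type*} [NormedAddCommGroup X] [NormedAddCommGroup F]
    (𝒳 : Set X) (g : ℝ → X → F) : Prop :=
  ∃ J' ⊆ Ici (0:ℝ), volume (Ici (0:ℝ) \ J') = 0 ∧
    ∀ K : Set X, IsCompact K → K ⊆ 𝒳 → ∃ L : ℝ, 0 ≤ L ∧
      ∀ t ∈ J', ∀ ξ ∈ K, ∀ ζ ∈ K, ‖g t ξ - g t ζ‖ ≤ L * ‖ξ - ζ‖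

/-- gγ is the limiting function of g along the sequence γ = {t_k}: g(t_k+s,ξ) → gγ(s,ξ)
for all ξ ∈ 𝒳 and all s outside a Lebesgue-null set. -/
def IsLimitAlong {X F : Type*} [TopologicalSpace F]
    (𝒳 : Set X) (g : ℝ → X → F) (γ : ℕ → ℝ) (glim : ℝ → X → F) : Prop :=
  ∃ Eγ : Set ℝ, volume Eγ = 0 ∧ ∀ ξ ∈ 𝒳, ∀ s : ℝ, s ∉ Eγ →
    Tendsto (fun k => g (γ k + s) ξ) atTop (nhds (glim s ξ))

/-- γ is an admissible sequence for g. -/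
def Admissible {X F : Type*} [TopologicalSpace F]
    (𝒳 : Set X) (g : ℝ → X → F) (γ : ℕ → ℝ) : Prop :=
  Tendsto γ atTop atTop ∧ ∃ glim : ℝ → X → F, IsLimitAlong 𝒳 g γ glim

/-- g is precompact: every sequence t_k → ∞ has an admissible subsequence. -/
def Precompact {X F : Type*} [TopologicalSpace F]
    (𝒳 : Set X) (g : ℝ → X → F) : Prop :=
  ∀ t : ℕ → ℝ, Tendsto t atTop atTop →
    ∃ φ : ℕ → ℕ, StrictMono φ ∧ Admissible 𝒳 g (t ∘ φ)

/-- (g, gh) is a zeroing pair. -/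
def ZeroingPair {X F G : Type*} [NormedAddCommGroup X] [NormedAddCommGroup F]
    [NormedAddCommGroup G] (𝒳 : Set X) (g : ℝ → X → F) (gh : ℝ → X → G) : Prop :=
  ∀ t : ℕ → ℝ, Tendsto t atTop atTop → ∀ K : Set X, IsCompact K → K ⊆ 𝒳 →
    ∀ ε : ℝ, 0 < ε → ∀ v : ℕ → X, (∀ k, v k ∈ K) → (∀ k, ε ≤ ‖v k‖) →
      Tendsto (fun k => g (t k) (v k)) atTop (nhds 0) →
      Tendsto (fun k => gh (t k) (v k)) atTop (nhds 0)

/-- Carathéodory conditions for a time-varying vector field on 𝒳. -/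
def Caratheodory {n : ℕ} (𝒳 : Set (E n)) (g : ℝ → E n → E n) : Prop :=
  (∀ ξ ∈ 𝒳, Measurable fun t => g t ξ) ∧
  (∀ᵐ t ∂volume.restrict (Ici (0:ℝ)), ContinuousOn (fun ξ => g t ξ) 𝒳) ∧
  ∀ K : Set (E n), IsCompact K → K ⊆ 𝒳 →
    ∃ m : ℝ → ℝ, (∀ a b : ℝ, IntervalIntegrable m volume a b) ∧
      ∀ᵐ t ∂volume.restrict (Ici (0:ℝ)), ∀ ξ ∈ K, ‖g t ξ‖ ≤ m t

/-! ### Solutions and trajectories of the switched system -/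

/-- A (forward) solution of ẋ = f(t,x,σ(t)) on [t0, tf), encoded through the equivalent
integral equation (x is locally absolutely continuous with ẋ(t) = f(t,x(t),σ(t)) a.e.). -/
structure Sol {n N : ℕ} (𝒳 : Set (E n)) (f : ℝ → E n → Fin N → E n) where
  x : ℝ → E n
  σ : ℝ → Fin N
  t0 : ℝ
  tf : EReal
  t0_nonneg : 0 ≤ t0
  t0_lt_tf : (t0 : EReal) < tf
  switching : IsSwitchingSignal σ
  mem : ∀ t : ℝ, t0 ≤ t → (t : EReal) < tf → x t ∈ 𝒳
  intg : ∀ a b : ℝ, t0 ≤ a → a ≤ b → (b : EReal) < tf →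
    IntervalIntegrable (fun τ => f τ (x τ) (σ τ)) volume a b
  sol : ∀ a b : ℝ, t0 ≤ a → a ≤ b → (b : EReal) < tf →
    x b = x a + ∫ τ in a..b, f τ (x τ) (σ τ)

variable {n N : ℕ} {𝒳 : Set (E n)} {f : ℝ → E n → Fin N → E n}

/-- t belongs to the domain [t0, tf) of the solution. -/
def Sol.InDom (T : Sol 𝒳 f) (t : ℝ) : Prop := T.t0 ≤ t ∧ (t : EReal) < T.tf

/-- A solution is maximal if it admits no proper extension (a trajectory is a maximal
solution together with its switching signal). -/
def Sol.IsMaximal (T : Sol 𝒳 f) : Prop :=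
  ¬ ∃ T' : Sol 𝒳 f, T'.σ = T.σ ∧ T'.t0 = T.t0 ∧ T.tf < T'.tf ∧
    ∀ t : ℝ, T.InDom t → T'.x t = T.x t

/-! ### Stability notions -/

/-- Uniform stability of a family of trajectories. -/
def US (𝒯 : Set (Sol 𝒳 f)) : Prop :=
  ∃ α : ℝ → ℝ, ∃ δ₀ : ℝ, ClassK α ∧ 0 < δ₀ ∧
    ∀ T ∈ 𝒯, ∀ s : ℝ, T.InDom s → ‖T.x s‖ ≤ δ₀ →
      ∀ t : ℝ, s ≤ t → (t : EReal) < T.tf → ‖T.x t‖ ≤ α ‖T.x s‖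

/-- Global uniform stability of a family of trajectories. -/
def GUS (𝒯 : Set (Sol 𝒳 f)) : Prop :=
  𝒳 = Set.univ ∧ ∃ α : ℝ → ℝ, ClassKInf α ∧
    ∀ T ∈ 𝒯, ∀ s : ℝ, T.InDom s →
      ∀ t : ℝ, s ≤ t → (t : EReal) < T.tf → ‖T.x t‖ ≤ α ‖T.x s‖

/-- Uniform asymptotic stability of a family of trajectories. -/
def UAS (𝒯 : Set (Sol 𝒳 f)) : Prop :=
  ∃ β : ℝ → ℝ → ℝ, ∃ δ₀ : ℝ, ClassKL β ∧ 0 < δ₀ ∧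
    ∀ T ∈ 𝒯, ∀ s : ℝ, T.InDom s → ‖T.x s‖ < δ₀ →
      ∀ t : ℝ, s ≤ t → (t : EReal) < T.tf → ‖T.x t‖ ≤ β ‖T.x s‖ (t - s)

/-- Global uniform asymptotic stability of a family of trajectories. -/
def GUAS (𝒯 : Set (Sol 𝒳 f)) : Prop :=
  𝒳 = Set.univ ∧ ∃ β : ℝ → ℝ → ℝ, ClassKL β ∧
    ∀ T ∈ 𝒯, ∀ s : ℝ, T.InDom s →
      ∀ t : ℝ, s ≤ t → (t : EReal) < T.tf → ‖T.x t‖ ≤ β ‖T.x s‖ (t - s)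

/-! ### Output maps, zeroing-output sequences and WZSD -/

/-- A 𝒯-zeroing-output sequence for the switched system with output map h. -/
def ZeroingOutputSeq {F : Type*} [NormedAddCommGroup F]
    (𝒯 : Set (Sol 𝒳 f)) (h : ℝ → E n → Fin N → F)
    (t : ℕ → ℝ) (T : ℕ → Sol 𝒳 f) : Prop :=
  Tendsto t atTop atTop ∧ (∀ k, T k ∈ 𝒯) ∧
  (∀ k : ℕ, (T k).t0 ≤ t k - k ∧ ((t k + k : ℝ) : EReal) < (T k).tf) ∧
  (∃ K : Set (E n), IsCompact K ∧ K ⊆ 𝒳 ∧ ∃ ε : ℝ, 0 < ε ∧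
    ∀ k : ℕ, ∀ s : ℝ, |s| ≤ (k : ℝ) →
      (T k).x (t k + s) ∈ K ∧ ε ≤ ‖(T k).x (t k + s)‖) ∧
  ∀ᵐ s : ℝ, Tendsto (fun k => h (t k + s) ((T k).x (t k + s)) ((T k).σ (t k + s)))
    atTop (nhds 0)

/-- The pair (h,f) is weakly zero-state detectable with respect to 𝒯:
there is no 𝒯-zeroing-output sequence. -/
def WZSD {F : Type*} [NormedAddCommGroup F]
    (𝒯 : Set (Sol 𝒳 f)) (h : ℝ → E n → Fin N → F) : Prop :=
  ¬ ∃ (t : ℕ → ℝ) (T : ℕ → Sol 𝒳 f), ZeroingOutputSeq 𝒯 h t T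

/-- Assumption 1: integral bound for the output along trajectories of 𝒯. -/
def IntegralOutputBound {F : Type*} [NormedAddCommGroup F]
    (𝒯 : Set (Sol 𝒳 f)) (h : ℝ → E n → Fin N → F) : Prop :=
  ∃ α : ℝ → ℝ, ContinuousOn α (Ici 0) ∧ α 0 = 0 ∧ (∀ r : ℝ, 0 < r → 0 < α r) ∧
    ∀ K : Set (E n), IsCompact K → K ⊆ 𝒳 → ∀ μ : ℝ, 0 < μ → ∃ M : ℝ, 0 < M ∧
      ∀ T ∈ 𝒯, ∀ s t : ℝ, T.t0 ≤ s → s < t → (t : EReal) < T.tf →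
        (∀ τ ∈ Icc s t, T.x τ ∈ K) →
        ∫ τ in s..t, α ‖h τ (T.x τ) (T.σ τ)‖ ≤ M + μ * (t - s)

/-! ### Coverings, limiting trajectories and reduced limiting control systems -/

/-- The set U_ξ = co{e_i : ξ ∈ χ_i} of control values compatible with the covering χ at ξ. -/
def Uset {N n : ℕ} (χ : Fin N → Set (E n)) (ξ : E n) : Set (Fin N → ℝ) :=
  convexHull ℝ {v : Fin N → ℝ | ∃ i, ξ ∈ χ i ∧ v = stdVec N i}

/-- 𝒯 is invariant with respect to the covering χ: x(t) ∈ χ_{σ(t)} along trajectories. -/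
def InvariantWrt (𝒯 : Set (Sol 𝒳 f)) (χ : Fin N → Set (E n)) : Prop :=
  ∀ T ∈ 𝒯, ∀ t : ℝ, T.InDom t → T.x t ∈ χ (T.σ t)

/-- The set 𝒮*_𝒯 of controls that are weak limits of time-translations of switching
signals of trajectories in 𝒯. -/
def SStar (𝒯 : Set (Sol 𝒳 f)) (u : ℝ → Fin N → ℝ) : Prop :=
  IsControl u ∧ ∃ (t : ℕ → ℝ) (T : ℕ → Sol 𝒳 f),
    Tendsto t atTop atTop ∧ (∀ k, T k ∈ 𝒯) ∧
    WeakConv (fun k s => ctrlOfSwitch (T k).σ (t k + s)) u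

/-- Limiting trajectory of the family 𝒯. -/
def LimitingTrajectory (𝒯 : Set (Sol 𝒳 f)) (xb : ℝ → E n) (ub : ℝ → Fin N → ℝ) : Prop :=
  Continuous xb ∧ (∀ t, xb t ∈ 𝒳) ∧ IsControl ub ∧
  ∃ (t : ℕ → ℝ) (T : ℕ → Sol 𝒳 f) (K : Set (E n)),
    Tendsto t atTop atTop ∧ (∀ k, T k ∈ 𝒯) ∧ IsCompact K ∧ K ⊆ 𝒳 ∧
    (∀ k : ℕ, (T k).t0 ≤ t k - k ∧ ((t k + k : ℝ) : EReal) < (T k).tf) ∧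
    (∀ k : ℕ, ∀ s : ℝ, |s| ≤ (k : ℝ) → (T k).x (t k + s) ∈ K) ∧
    (∀ Tc : ℝ, 0 < Tc →
      TendstoUniformlyOn (fun k s => (T k).x (t k + s)) xb atTop (Icc (-Tc) Tc)) ∧
    WeakConv (fun k s => ctrlOfSwitch (T k).σ (t k + s)) ub

/-- 𝒯-zeroing-output limiting trajectory. -/
def ZeroingOutputLimitingTrajectory {F : Type*} [NormedAddCommGroup F]
    (𝒯 : Set (Sol 𝒳 f)) (h : ℝ → E n → Fin N → F)
    (xb : ℝ → E n) (ub : ℝ → Fin N → ℝ) : Prop :=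
  Continuous xb ∧ (∀ t, xb t ∈ 𝒳) ∧ IsControl ub ∧
  ∃ (t : ℕ → ℝ) (T : ℕ → Sol 𝒳 f), ZeroingOutputSeq 𝒯 h t T ∧
    (∀ Tc : ℝ, 0 < Tc →
      TendstoUniformlyOn (fun k s => (T k).x (t k + s)) xb atTop (Icc (-Tc) Tc)) ∧
    WeakConv (fun k s => ctrlOfSwitch (T k).σ (t k + s)) ub

/-- Locally absolutely continuous function on ℝ (indefinite integral of a locally
integrable function). -/
def LocAC {V : Type*} [NormedAddCommGroup V] [NormedSpace ℝ V] (x : ℝ → V) : Prop :=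
  ∃ g : ℝ → V, (∀ a b : ℝ, IntervalIntegrable g volume a b) ∧
    ∀ t : ℝ, x t = x 0 + ∫ s in (0:ℝ)..t, g s

/-- A complete trajectory of the reduced limiting control system Σ_γ determined by the
limiting functions fl = (f̂_{i,γ}) and hl = (h_{i,γ}), the covering χ and the constraint
u ∈ 𝒮*_𝒯: x is locally absolutely continuous and, for a.e. t, u(t) ∈ U_{x(t)},
x′(t) = Σ_i u_i(t) f̂_{i,γ}(t,x(t)) and Σ_i u_i(t) |h_{i,γ}(t,x(t))| = 0. -/
def CompleteTrajOf {F : Type*} [NormedAddCommGroup F]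
    (𝒯 : Set (Sol 𝒳 f)) (χ : Fin N → Set (E n))
    (fl : Fin N → ℝ → E n → E n) (hl : Fin N → ℝ → E n → F)
    (x : ℝ → E n) (u : ℝ → Fin N → ℝ) : Prop :=
  (∀ t, x t ∈ 𝒳) ∧ LocAC x ∧ SStar 𝒯 u ∧
  ∀ᵐ t : ℝ, u t ∈ Uset χ (x t) ∧
    HasDerivAt x (∑ i, u t i • fl i t (x t)) t ∧
    ∑ i, u t i * ‖hl i t (x t)‖ = 0

/-- A bounded complete trajectory: the state stays in a compact subset of 𝒳. -/
def BoundedRange (𝒳 : Set (E n)) (x : ℝ → E n) : Prop :=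
  ∃ K : Set (E n), IsCompact K ∧ K ⊆ 𝒳 ∧ ∀ t : ℝ, x t ∈ K

end SwitchedSys

open SwitchedSys Filter Set MeasureTheory

/-- Construction of a class KL bound from boundedness, stability and attractivity. -/
theorem exists_KL (A : ℝ → ℝ → ℝ → Prop)
    (hpos : ∀ r t y, A r t y → 0 ≤ r ∧ 0 ≤ t ∧ 0 ≤ y)
    (hb : ∀ r, ∃ R, ∀ r' t y, A r' t y → r' ≤ r → y ≤ R)
    (hs : ∀ ε > 0, ∃ δ > 0, ∀ r' t y, A r' t y → r' ≤ δ → y ≤ ε)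
    (ha : ∀ r, ∀ ε > 0, ∃ T, ∀ r' t y, A r' t y → r' ≤ r → T ≤ t → y ≤ ε) :
    ∃ β, ClassKL β ∧ ∀ r t y, A r t y → y ≤ β r t := by
  classical
  set S : ℝ → ℝ → Set ℝ := fun r t => insert 0 {y | ∃ r' t', A r' t' y ∧ r' ≤ r ∧ t ≤ t'} with hS
  set ψ : ℝ → ℝ → ℝ := fun r t => sSup (S r t) with hψ
  have hne : ∀ r t, (S r t).Nonempty := fun r t => ⟨0, mem_insert _ _⟩
  have hbdd : ∀ r t, BddAbove (S r t) := by
    intro r t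
    obtain ⟨R, hR⟩ := hb r
    refine ⟨max 0 R, ?_⟩
    rintro y (rfl | ⟨r', t', h, h1, h2⟩)
    · exact le_max_left _ _
    · exact (hR _ _ _ h h1).trans (le_max_right _ _)
  have hψ0 : ∀ r t, 0 ≤ ψ r t := fun r t => le_csSup (hbdd r t) (mem_insert _ _)
  have hmono : ∀ t, Monotone fun r => ψ r t := by
    intro t r₁ r₂ h
    apply csSup_le_csSup (hbdd _ _) (hne _ _)
    rintro y (rfl | ⟨r', t', h0, h1, h2⟩)
    · exact mem_insert _ _
    · exact Or.inr ⟨r', t', h0, h1.trans h, h2⟩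
  have hanti : ∀ r, Antitone fun t => ψ r t := by
    intro r t₁ t₂ h
    apply csSup_le_csSup (hbdd _ _) (hne _ _)
    rintro y (rfl | ⟨r', t', h0, h1, h2⟩)
    · exact mem_insert _ _
    · exact Or.inr ⟨r', t', h0, h1, h.trans h2⟩
  have hle : ∀ r t y, A r t y → y ≤ ψ r t := fun r t y h =>
    le_csSup (hbdd r t) (Or.inr ⟨r, t, h, le_rfl, le_rfl⟩)
  have hsmall : ∀ ε > 0, ∃ δ > 0, ∀ r ≤ δ, ∀ t, ψ r t ≤ ε := by
    intro ε hε
    obtain ⟨δ, hδ, h⟩ := hs ε hε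
    refine ⟨δ, hδ, fun r hr t => csSup_le (hne _ _) ?_⟩
    rintro y (rfl | ⟨r', t', h0, h1, h2⟩)
    · exact hε.le
    · exact h _ _ _ h0 (h1.trans hr)
  have hatt : ∀ r, ∀ ε > 0, ∃ T, ∀ t ≥ T, ψ r t ≤ ε := by
    intro r ε hε
    obtain ⟨T, h⟩ := ha r ε hε
    refine ⟨T, fun t ht => csSup_le (hne _ _) ?_⟩
    rintro y (rfl | ⟨r', t', h0, h1, h2⟩)
    · exact hε.le
    · exact h _ _ _ h0 h1 (ht.le.trans h2)
  have hzero : ∀ t, ψ 0 t = 0 := by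
    intro t
    refine le_antisymm (le_of_forall_pos_le_add fun ε hε => ?_) (hψ0 _ _)
    obtain ⟨δ, hδ, h⟩ := hsmall ε hε
    linarith [h 0 hδ.le t]
  have hint : ∀ r t, 0 ≤ r → IntervalIntegrable (fun l => ψ (r * l) t) volume 1 2 := by
    intro r t hr
    apply Monotone.intervalIntegrable
    intro a b hab
    exact hmono t (mul_le_mul_of_nonneg_left hab hr)
  have hI0 : ∀ r t, 0 ≤ ∫ l in (1:ℝ)..2, ψ (r * l) t := fun r t =>
    intervalIntegral.integral_nonneg (by norm_num) fun _ _ => hψ0 _ _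
  have hIle : ∀ r t, 0 ≤ r → ∫ l in (1:ℝ)..2, ψ (r * l) t ≤ ψ (2 * r) t := by
    intro r t hr
    have := intervalIntegral.integral_mono_on (a := 1) (b := 2) (by norm_num) (hint r t hr)
      (intervalIntegrable_const (c := ψ (2 * r) t)) (fun l hl => hmono t (by nlinarith [hl.2]))
    simpa [show (2:ℝ) - 1 = 1 by norm_num] using this
  have hIge : ∀ r t, 0 ≤ r → ψ r t ≤ ∫ l in (1:ℝ)..2, ψ (r * l) t := by
    intro r t hr
    have := intervalIntegral.integral_mono_on (a := 1) (b := 2) (by norm_num)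
      (intervalIntegrable_const (c := ψ r t)) (hint r t hr)
      (fun l hl => hmono t (by nlinarith [hl.1]))
    simpa [show (2:ℝ) - 1 = 1 by norm_num] using this
  have hImono : ∀ t r₁ r₂, 0 ≤ r₁ → r₁ ≤ r₂ →
      ∫ l in (1:ℝ)..2, ψ (r₁ * l) t ≤ ∫ l in (1:ℝ)..2, ψ (r₂ * l) t := by
    intro t r₁ r₂ h1 h2
    exact intervalIntegral.integral_mono_on (by norm_num) (hint _ t h1) (hint _ t (h1.trans h2))
      (fun l hl => hmono t (by nlinarith [hl.1]))
  refine ⟨fun r t => (∫ l in (1:ℝ)..2, ψ (r * l) t) + r * Real.exp (-t), ⟨?_, ?_⟩, ?_⟩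
  · intro t ht
    refine ⟨⟨?_, ?_, ?_⟩, ?_⟩
    · refine ContinuousOn.add ?_ (by fun_prop)
      intro r hr
      rcases eq_or_lt_of_le (show (0:ℝ) ≤ r from hr) with h0 | h0
      · subst h0
        rw [ContinuousWithinAt, Metric.tendsto_nhdsWithin_nhds]
        intro ε hε
        obtain ⟨δ, hδ, h⟩ := hsmall (ε / 2) (by positivity)
        refine ⟨δ / 2, by positivity, fun {x} hx hd => ?_⟩
        have hx' : (0:ℝ) ≤ x := hx
        have e : (∫ l in (1:ℝ)..2, ψ (0 * l) t) = 0 := by simp [hzero]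
        rw [e, Real.dist_eq, sub_zero, abs_of_nonneg (hI0 _ _)]
        rw [Real.dist_eq, sub_zero, abs_of_nonneg hx'] at hd
        linarith [hIle x t hx', h (2 * x) (by linarith) t]
      · apply ContinuousAt.continuousWithinAt
        have hP : Continuous fun b => ∫ l in (0:ℝ)..b, ψ l t :=
          intervalIntegral.continuous_primitive (fun a b => (hmono t).intervalIntegrable) 0
        have : (fun r => ∫ l in (1:ℝ)..2, ψ (r * l) t) =ᶠ[𝓝 r] fun r =>
            r⁻¹ * ((∫ l in (0:ℝ)..(r * 2), ψ l t) - ∫ l in (0:ℝ)..(r * 1), ψ l t) := by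
          filter_upwards [lt_mem_nhds h0] with c hc
          rw [intervalIntegral.integral_comp_mul_left (fun x => ψ x t) hc.ne',
            intervalIntegral.integral_interval_sub_left (hmono t).intervalIntegrable
              (hmono t).intervalIntegrable, smul_eq_mul]
        refine ContinuousAt.congr ?_ this.symm
        refine (continuousAt_inv₀ h0.ne').mul (ContinuousAt.sub ?_ ?_)
        · exact (hP.comp (continuous_id.mul continuous_const)).continuousAt
        · exact (hP.comp (continuous_id.mul continuous_const)).continuousAt
    · intro a ha' b hb' hab
      have := hImono t a b ha' hab.le
      have h2 : a * Real.exp (-t) < b * Real.exp (-t) :=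
        mul_lt_mul_of_pos_right hab (Real.exp_pos _)
      simp only
      linarith
    · simp [hzero]
    · refine tendsto_atTop_mono (fun r => ?_)
        (Filter.Tendsto.atTop_mul_const (Real.exp_pos (-t)) tendsto_id)
      simp only [id]
      linarith [hI0 r t]
  · intro r hr
    constructor
    · intro a ha' b hb' hab
      have h1 : ∫ l in (1:ℝ)..2, ψ (r * l) b ≤ ∫ l in (1:ℝ)..2, ψ (r * l) a :=
        intervalIntegral.integral_mono_on (by norm_num) (hint _ _ hr) (hint _ _ hr)
          (fun l hl => hanti _ hab)
      have h2 : r * Real.exp (-b) ≤ r * Real.exp (-a) :=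
        mul_le_mul_of_nonneg_left (Real.exp_le_exp.2 (by linarith)) hr
      simp only
      linarith
    · have e1 : Tendsto (fun t => r * Real.exp (-t)) atTop (𝓝 0) := by
        simpa using (Real.tendsto_exp_neg_atTop_nhds_zero).const_mul r
      have e2 : Tendsto (fun t => ∫ l in (1:ℝ)..2, ψ (r * l) t) atTop (𝓝 0) := by
        rw [Metric.tendsto_atTop]
        intro ε hε
        obtain ⟨T, hT⟩ := hatt (2 * r) (ε / 2) (by positivity)
        refine ⟨T, fun t ht => ?_⟩
        rw [Real.dist_eq, sub_zero, abs_of_nonneg (hI0 _ _)]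
        linarith [hIle r t hr, hT t ht]
      simpa using e2.add e1
  · intro r t y h
    obtain ⟨h0, h1, h2⟩ := hpos _ _ _ h
    have := hIge r t h0
    have := hle r t y h
    have : 0 ≤ r * Real.exp (-t) := by positivity
    simp only
    linarith


theorem exists_subseq_all {ι : Type*} [Finite ι] (P : ι → (ℕ → ℕ) → Prop)
    (hsub : ∀ i (φ ψ : ℕ → ℕ), P i φ → StrictMono ψ → P i (φ ∘ ψ))
    (hex : ∀ i (φ : ℕ → ℕ), StrictMono φ → ∃ ψ : ℕ → ℕ, StrictMono ψ ∧ P i (φ ∘ ψ)) :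
    ∃ φ : ℕ → ℕ, StrictMono φ ∧ ∀ i, P i φ := by
  classical
  cases nonempty_fintype ι
  suffices h : ∀ s : Finset ι, ∃ φ : ℕ → ℕ, StrictMono φ ∧ ∀ i ∈ s, P i φ by
    obtain ⟨φ, h1, h2⟩ := h Finset.univ
    exact ⟨φ, h1, fun i => h2 i (Finset.mem_univ _)⟩
  intro s
  induction s using Finset.induction_on with
  | empty => exact ⟨id, strictMono_id, by simp⟩
  | insert a s _ ih =>
    obtain ⟨φ, h1, h2⟩ := ih
    obtain ⟨ψ, h3, h4⟩ := hex a φ h1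
    refine ⟨φ ∘ ψ, h1.comp h3, fun i hi => ?_⟩
    rcases Finset.mem_insert.1 hi with rfl | hi
    · exact h4
    · exact hsub _ _ _ (h2 i hi) h3

/-- Pointwise Arzela-Ascoli for equi-Lipschitz sequences with values in a compact set. -/
theorem exists_subseq_lipschitz {X : Type*} [NormedAddCommGroup X] (K : Set X) (hK : IsCompact K)
    (L : NNReal) (y : ℕ → ℝ → X)
    (hyK : ∀ k s, y k s ∈ K) (hL : ∀ k, LipschitzWith L (y k)) :
    ∃ (φ : ℕ → ℕ) (x : ℝ → X), StrictMono φ ∧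
      ∀ s, Tendsto (fun k => y (φ k) s) atTop (𝓝 (x s)) := by
  have hc : IsCompact (Set.univ.pi fun _ : ℚ => K) := isCompact_univ_pi fun _ => hK
  obtain ⟨z, -, φ, hφ, hz⟩ := hc.tendsto_subseq (x := fun k (q : ℚ) => y k q)
    (fun k q _ => hyK k q)
  rw [tendsto_pi_nhds] at hz
  have key : ∀ s : ℝ, ∃ v, Tendsto (fun k => y (φ k) s) atTop (𝓝 v) := by
    intro s
    have hcau : CauchySeq fun k => y (φ k) s := by
      rw [Metric.cauchySeq_iff]
      intro ε hε
      obtain ⟨q, hq1, hq2⟩ := exists_rat_btwn (show s < s + ε / (4 * (L + 1)) by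
        have : 0 < ε / (4 * ((L:ℝ) + 1)) := by positivity
        linarith)
      have hqs : ∀ k, dist (y k s) (y k q) ≤ ε / 4 := by
        intro k
        refine ((hL k).dist_le_mul s q).trans ?_
        have h1 : dist s (q:ℝ) ≤ ε / (4 * (L + 1)) := by
          rw [Real.dist_eq, abs_le]; constructor <;> linarith
        calc (L:ℝ) * dist s q ≤ (L + 1) * (ε / (4 * (L + 1))) := by
              gcongr
              linarith
          _ = ε / 4 := by field_simp
      obtain ⟨M, hM⟩ := Metric.cauchySeq_iff.1 (hz q).cauchySeq (ε / 4) (by positivity)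
      refine ⟨M, fun m hm k hk => ?_⟩
      have h1 := hqs (φ m)
      have h2 := hqs (φ k)
      have h3 : dist (y (φ m) q) (y (φ k) q) < ε / 4 := hM m hm k hk
      have h4 := dist_triangle4 (y (φ m) s) (y (φ m) q) (y (φ k) q) (y (φ k) s)
      rw [dist_comm (y (φ k) q)] at h4
      linarith
    obtain ⟨v, -, hv⟩ := cauchySeq_tendsto_of_isComplete hK.isComplete (fun k => hyK (φ k) s) hcau
    exact ⟨v, hv⟩
  choose x hx using key
  exact ⟨φ, x, hφ, hx⟩

theorem exists_weak_subseq {H : Type*} [NormedAddCommGroup H] [InnerProductSpace ℝ H]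
    [CompleteSpace H] [TopologicalSpace.SeparableSpace H] (V : ℕ → H) (C : ℝ)
    (hV : ∀ k, ‖V k‖ ≤ C) :
    ∃ (φ : ℕ → ℕ) (v : H), StrictMono φ ∧
      ∀ h : H, Tendsto (fun k => inner ℝ (V (φ k)) h) atTop (𝓝 (inner ℝ v h)) := by
  have hs := WeakDual.isSeqCompact_closedBall ℝ H (0 : StrongDual ℝ H) C
  obtain ⟨a, -, φ, hφ, ha⟩ := hs (x := fun k => StrongDual.toWeakDual (InnerProductSpace.toDual ℝ H (V k)))
    (fun k => by simpa using hV k)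
  refine ⟨φ, (InnerProductSpace.toDual ℝ H).symm (WeakDual.toStrongDual a), hφ, fun h => ?_⟩
  have := ((WeakDual.eval_continuous (𝕜 := ℝ) h).tendsto a).comp ha
  have h2 : inner ℝ ((InnerProductSpace.toDual ℝ H).symm (WeakDual.toStrongDual a)) h = a h := by
    rw [InnerProductSpace.toDual_symm_apply]; rfl
  rw [h2]
  exact this

/-- Measurability of superposition with a Caratheodory map. -/
theorem aesm_carath {X F : Type*} [NormedAddCommGroup X] [SecondCountableTopology X]
    [MeasurableSpace X] [BorelSpace X] [NormedAddCommGroup F]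
    (K : Set X) (g : ℝ → X → F)
    (hm : ∀ ξ ∈ K, StronglyMeasurable (fun t => g t ξ)) (μ : Measure ℝ)
    (hc : ∀ᵐ t ∂μ, ContinuousOn (g t) K) (y : ℝ → X) (hy : Measurable y)
    (hyK : ∀ t, y t ∈ K) : AEStronglyMeasurable (fun t => g t (y t)) μ := by
  classical
  rw [ae_iff] at hc
  obtain ⟨Z, hZ1, hZ2, hZ3⟩ := exists_measurable_superset_of_null hc
  let g' : K → ℝ → F := fun ξ t => if t ∈ Z then 0 else g t ξ
  have h1 : StronglyMeasurable (Function.uncurry g') := by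
    apply stronglyMeasurable_uncurry_of_continuous_of_stronglyMeasurable
    · intro t
      by_cases ht : t ∈ Z
      · simp only [g', ht, if_true]; exact continuous_const
      · simp only [g', ht, if_false]
        have : ContinuousOn (g t) K := by
          by_contra hcon
          exact ht (hZ1 hcon)
        exact continuousOn_iff_continuous_domRestrict.1 this
    · intro ξ
      exact StronglyMeasurable.ite hZ2 stronglyMeasurable_const (hm ξ ξ.2)
  have h2 : Measurable fun t : ℝ => ((⟨y t, hyK t⟩ : K), t) :=
    (hy.subtype_mk).prodMk measurable_id
  refine ⟨_, h1.comp_measurable h2, ?_⟩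
  have : ∀ᵐ t ∂μ, t ∉ Z := by rw [ae_iff]; simpa using hZ3
  filter_upwards [this] with t ht
  simp [g', Function.uncurry, ht]


/-- Sequential weak compactness for uniformly bounded functions on the line. -/
theorem exists_weak_limit (b : ℕ → ℝ → ℝ) (hm : ∀ k, Measurable (b k))
    (hb : ∀ k s, |b k s| ≤ 1) :
    ∃ (φ : ℕ → ℕ) (u : ℝ → ℝ), StrictMono φ ∧ Measurable u ∧
      (∀ M : ℝ, IntegrableOn u (Icc (-M) M)) ∧
      ∀ g : ℝ → ℝ, AEStronglyMeasurable g volume → (∃ C, ∀ᵐ s, |g s| ≤ C) →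
        (∃ M, ∀ s, M < |s| → g s = 0) →
        Tendsto (fun k => ∫ s, b (φ k) s * g s) atTop (𝓝 (∫ s, u s * g s)) := by
  have hw : MemLp (fun s : ℝ => Real.exp (-s ^ 2)) 2 volume := by
    rw [memLp_two_iff_integrable_sq (by fun_prop)]
    refine (integrable_exp_neg_mul_sq (b := 2) (by norm_num)).congr (ae_of_all _ fun s => ?_)
    simp only [← Real.exp_nat_mul]
    congr 1; push_cast; ring
  have hbw : ∀ k, MemLp (fun s => b k s * Real.exp (-s ^ 2)) 2 volume := by
    intro k
    refine hw.mono ((hm k).mul (by fun_prop)).aestronglyMeasurable (ae_of_all _ fun s => ?_)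
    rw [norm_mul]
    exact mul_le_of_le_one_left (norm_nonneg _) (hb k s)
  have : Fact ((2 : ENNReal) ≠ ⊤) := ⟨by norm_num⟩
  obtain ⟨φ, v, hφ, hv⟩ := exists_weak_subseq (fun k => (hbw k).toLp _) ‖hw.toLp _‖ (by
    intro k
    apply Lp.norm_le_norm_of_ae_le
    filter_upwards [(hbw k).coeFn_toLp, hw.coeFn_toLp] with s h1 h2
    rw [h1, h2, norm_mul]
    exact mul_le_of_le_one_left (norm_nonneg _) (hb k s))
  have hvm : Measurable (v : ℝ → ℝ) := (Lp.stronglyMeasurable v).measurable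
  refine ⟨φ, fun s => v s * Real.exp (s ^ 2), hφ, hvm.mul (by fun_prop), ?_, ?_⟩
  · intro M
    have h1 : IntegrableOn (v : ℝ → ℝ) (Icc (-M) M) := by
      have : MemLp (v : ℝ → ℝ) 2 (volume.restrict (Icc (-M) M)) := (Lp.memLp v).restrict _
      exact this.integrable (by norm_num)
    exact h1.mul_continuousOn (by fun_prop) isCompact_Icc
  · rintro g hgm ⟨C, hC⟩ ⟨M, hM⟩
    have hh : MemLp (fun s => g s * Real.exp (s ^ 2)) 2 volume := by
      have h2 : MemLp (fun s => g s * Real.exp (s ^ 2)) 2 (volume.restrict (Icc (-M) M)) := by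
        refine MemLp.of_bound (hgm.mul (by fun_prop)).restrict (C * Real.exp (M ^ 2)) ?_
        filter_upwards [ae_restrict_of_ae hC, ae_restrict_mem measurableSet_Icc] with s h1 h2
        rw [norm_mul, Real.norm_eq_abs, Real.norm_eq_abs, Real.abs_exp]
        have : s ^ 2 ≤ M ^ 2 := by nlinarith [h2.1, h2.2]
        have := (abs_nonneg _).trans h1
        gcongr
      rw [← memLp_indicator_iff_restrict measurableSet_Icc] at h2
      convert h2 using 1
      ext s
      by_cases hs : s ∈ Icc (-M) M
      · simp [hs]
      · rw [indicator_of_notMem hs, hM s, zero_mul]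
        by_contra hcon
        exact hs (abs_le.1 (not_lt.1 hcon))
    have := hv (hh.toLp _)
    simp only [L2.inner_def] at this
    convert this using 2
    · rename_i k
      apply integral_congr_ae
      filter_upwards [(hbw (φ k)).coeFn_toLp, hh.coeFn_toLp] with s h1 h2
      rw [h1, h2]
      simp only [RCLike.inner_apply, conj_trivial]
      have : Real.exp (s ^ 2) * Real.exp (-s ^ 2) = 1 := by rw [← Real.exp_add]; simp
      linear_combination (-(b (φ k) s * g s)) * this
    · apply integral_congr_ae
      filter_upwards [hh.coeFn_toLp] with s h2
      rw [h2]
      simp only [RCLike.inner_apply, conj_trivial]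
      ring

theorem ae_nonneg_of_loc (u : ℝ → ℝ) (hi : ∀ M : ℝ, IntegrableOn u (Icc (-M) M))
    (h : ∀ (M : ℝ) (s : Set ℝ), MeasurableSet s → 0 ≤ ∫ x in s ∩ Icc (-M) M, u x) :
    ∀ᵐ x, 0 ≤ u x := by
  have h1 : ∀ k : ℕ, ∀ᵐ x, x ∈ Icc (-(k:ℝ)) k → 0 ≤ u x := by
    intro k
    rw [← ae_restrict_iff' measurableSet_Icc]
    refine ae_nonneg_of_forall_setIntegral_nonneg (hi k) fun s hs _ => ?_
    rw [Measure.restrict_restrict hs]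
    exact h k s hs
  filter_upwards [ae_all_iff.2 h1] with x hx
  obtain ⟨k, hk⟩ := exists_nat_ge |x|
  exact hx k (abs_le.1 hk)

/-- Sequential weak compactness of the set of controls. -/
theorem exists_control_limit {N : ℕ} (w : ℕ → ℝ → Fin N) (hw : ∀ k, Measurable (w k)) :
    ∃ (φ : ℕ → ℕ) (u : ℝ → Fin N → ℝ), StrictMono φ ∧ IsControl u ∧
      ∀ i, ∀ g : ℝ → ℝ, AEStronglyMeasurable g volume → (∃ C, ∀ᵐ s, |g s| ≤ C) →
        (∃ M, ∀ s, M < |s| → g s = 0) →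
        Tendsto (fun k => ∫ s, (if w (φ k) s = i then 1 else 0) * g s) atTop
          (𝓝 (∫ s, u s i * g s)) := by
  classical
  have hbm : ∀ i k, Measurable (fun s => if w k s = i then (1:ℝ) else 0) := fun i k =>
    Measurable.ite (hw k (measurableSet_singleton i)) measurable_const measurable_const
  obtain ⟨φ, hφ, hP⟩ := exists_subseq_all (ι := Fin N) (fun i φ => ∃ u : ℝ → ℝ, Measurable u ∧
      (∀ M : ℝ, IntegrableOn u (Icc (-M) M)) ∧
      ∀ g : ℝ → ℝ, AEStronglyMeasurable g volume → (∃ C, ∀ᵐ s, |g s| ≤ C) →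
        (∃ M, ∀ s, M < |s| → g s = 0) →
        Tendsto (fun k => ∫ s, (if w (φ k) s = i then 1 else 0) * g s) atTop
          (𝓝 (∫ s, u s * g s)))
    (by
      rintro i φ ψ ⟨u, h1, h2, h3⟩ hψ
      exact ⟨u, h1, h2, fun g a b c => (h3 g a b c).comp hψ.tendsto_atTop⟩)
    (by
      intro i φ _
      obtain ⟨ψ, u, h1, h2⟩ := exists_weak_limit
        (fun k s => if w (φ k) s = i then (1:ℝ) else 0) (fun k => hbm i (φ k))
        (fun k s => by split_ifs <;> simp)
      exact ⟨ψ, h1, u, h2⟩)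
  choose u hum hui hut using hP
  have hind : ∀ i (M : ℝ) (s : Set ℝ), MeasurableSet s →
      Tendsto (fun k => ∫ x in s ∩ Icc (-M) M, (if w (φ k) x = i then (1:ℝ) else 0)) atTop
          (𝓝 (∫ x in s ∩ Icc (-M) M, u i x)) := by
    intro i M s hs
    have hms := hs.inter (measurableSet_Icc (a := -M) (b := M))
    have := hut i ((s ∩ Icc (-M) M).indicator fun _ => 1)
      (aestronglyMeasurable_const.indicator hms) ⟨1, ae_of_all _ fun x => by
        by_cases hx : x ∈ s ∩ Icc (-M) M
        · rw [indicator_of_mem hx]; simp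
        · rw [indicator_of_notMem hx]; simp⟩
      ⟨M, fun x hx => by
        rw [indicator_of_notMem]
        rintro ⟨-, h⟩
        exact absurd (abs_le.2 h) (not_le.2 hx)⟩
    convert this using 2
    · rw [← integral_indicator hms]
      congr 1; ext x
      by_cases hx : x ∈ s ∩ Icc (-M) M
      · rw [indicator_of_mem hx, indicator_of_mem hx, mul_one]
      · rw [indicator_of_notMem hx, indicator_of_notMem hx, mul_zero]
    · rw [← integral_indicator hms]
      congr 2; ext x
      by_cases hx : x ∈ s ∩ Icc (-M) M
      · rw [indicator_of_mem hx, indicator_of_mem hx, mul_one]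
      · rw [indicator_of_notMem hx, indicator_of_notMem hx, mul_zero]
  have hu0 : ∀ i, ∀ᵐ x, 0 ≤ u i x := by
    intro i
    refine ae_nonneg_of_loc _ (hui i) fun M s hs => ?_
    refine ge_of_tendsto' (hind i M s hs) fun k => ?_
    exact integral_nonneg fun x => by simp only [Pi.zero_apply]; split_ifs <;> simp
  have hfin : ∀ (M : ℝ) (s : Set ℝ), volume (s ∩ Icc (-M) M) ≠ ⊤ := fun M s =>
    (lt_of_le_of_lt (measure_mono inter_subset_right) measure_Icc_lt_top).ne
  have hsum : ∀ (M : ℝ) (s : Set ℝ), MeasurableSet s →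
      ∫ x in s ∩ Icc (-M) M, ∑ i, u i x = ∫ x in s ∩ Icc (-M) M, (1:ℝ) := by
    intro M s hs
    have h1 : Tendsto (fun k => ∑ i, ∫ x in s ∩ Icc (-M) M, (if w (φ k) x = i then (1:ℝ) else 0))
        atTop (𝓝 (∑ i, ∫ x in s ∩ Icc (-M) M, u i x)) :=
      tendsto_finsetSum _ fun i _ => hind i M s hs
    rw [integral_finsetSum _ fun i _ => (hui i M).mono_set inter_subset_right]
    refine tendsto_nhds_unique h1 ?_
    refine tendsto_const_nhds.congr fun k => ?_
    rw [← integral_finsetSum]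
    · simp
    · intro i _
      refine Integrable.mono' (g := fun _ => (1:ℝ)) (integrableOn_const (hfin M s))
        (hbm i _).aestronglyMeasurable (ae_of_all _ fun x => ?_)
      split_ifs <;> simp
  have hsi : ∀ M : ℝ, IntegrableOn (fun x => ∑ i, u i x) (Icc (-M) M) := fun M =>
    integrable_finsetSum _ fun i _ => hui i M
  have hc1 : ∀ M : ℝ, IntegrableOn (fun _ : ℝ => (1:ℝ)) (Icc (-M) M) := fun M =>
    integrableOn_const measure_Icc_lt_top.ne
  have hu1 : ∀ᵐ x, 0 ≤ (∑ i, u i x) - 1 := by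
    refine ae_nonneg_of_loc _ (fun M => (hsi M).sub (hc1 M)) fun M s hs => ?_
    rw [integral_sub ((hsi M).mono_set inter_subset_right) ((hc1 M).mono_set inter_subset_right),
      hsum M s hs, sub_self]
  have hu2 : ∀ᵐ x, 0 ≤ 1 - (∑ i, u i x) := by
    refine ae_nonneg_of_loc _ (fun M => (hc1 M).sub (hsi M)) fun M s hs => ?_
    rw [integral_sub ((hc1 M).mono_set inter_subset_right) ((hsi M).mono_set inter_subset_right),
      hsum M s hs, sub_self]
  have hsx : ∀ᵐ x, (fun i => u i x) ∈ simplexU N := by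
    filter_upwards [ae_all_iff.2 hu0, hu1, hu2] with x h1 h2 h3
    exact ⟨h1, by linarith⟩
  let G : Set ℝ := {x | (fun i => u i x) ∈ simplexU N}
  have hum' : Measurable fun x i => u i x := measurable_pi_lambda _ hum
  have hG : MeasurableSet G := by
    have : G = (⋂ i, {x | 0 ≤ u i x}) ∩ {x | ∑ i, u i x = 1} := by
      ext x; simp [G, simplexU]
    rw [this]
    exact (MeasurableSet.iInter fun i => measurableSet_le measurable_const (hum i)).inter
      (measurableSet_eq_fun (Finset.measurable_fun_sum _ fun i _ => hum i) measurable_const)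
  refine ⟨φ, fun x => if x ∈ G then (fun i => u i x) else stdVec N (w 0 0), hφ,
    ⟨Measurable.ite hG hum' measurable_const, ?_⟩, ?_⟩
  · intro t
    by_cases ht : t ∈ G
    · simp only [ht, if_true]; exact ht
    · simp only [ht, if_false]
      refine ⟨fun i => ?_, by simp [stdVec]⟩
      simp only [stdVec]; split_ifs <;> simp
  · intro i g a b c
    refine (hut i g a b c).congr' ?_ |>.trans ?_
    · exact EventuallyEq.rfl
    · apply le_of_eq
      congr 1
      apply integral_congr_ae
      filter_upwards [hsx] with x hx
      have : x ∈ G := hx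
      simp [this]


theorem unifBounded_all {N : ℕ} {X F : Type*} [TopologicalSpace X] [NormedAddCommGroup F]
    {𝒳 : Set X} (g : Fin N → ℝ → X → F) (h : ∀ i, UnifBounded 𝒳 (g i))
    (K : Set X) (hK : IsCompact K) (hK' : K ⊆ 𝒳) :
    ∃ C : ℝ, 0 ≤ C ∧ ∀ᵐ t : ℝ, 0 ≤ t → ∀ i, ∀ ξ ∈ K, ‖g i t ξ‖ ≤ C := by
  have : ∀ i, ∃ C : ℝ, ∀ᵐ t : ℝ, 0 ≤ t → ∀ ξ ∈ K, ‖g i t ξ‖ ≤ C := by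
    intro i
    obtain ⟨J, hJ1, hJ2, hJ3⟩ := h i
    obtain ⟨C, hC⟩ := hJ3 K hK hK'
    refine ⟨C, ?_⟩
    have : ∀ᵐ t : ℝ, t ∉ Ici (0:ℝ) \ J := measure_eq_zero_iff_ae_notMem.1 hJ2
    filter_upwards [this] with t ht h0
    refine hC t ?_
    by_contra hcon
    exact ht ⟨h0, hcon⟩
  choose C hC using this
  refine ⟨∑ i, |C i|, Finset.sum_nonneg fun _ _ => abs_nonneg _, ?_⟩
  filter_upwards [ae_all_iff.2 hC] with t ht h0 i ξ hξ
  calc ‖g i t ξ‖ ≤ C i := ht i h0 ξ hξ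
    _ ≤ |C i| := le_abs_self _
    _ ≤ ∑ i, |C i| := Finset.single_le_sum (f := fun i => |C i|) (fun _ _ => abs_nonneg _) (Finset.mem_univ i)

theorem contXi_ae {X F : Type*} [NormedAddCommGroup X] [NormedAddCommGroup F]
    {𝒳 : Set X} (g : ℝ → X → F) (h : ContXiUnifT 𝒳 g)
    (K : Set X) (hK : IsCompact K) (hK' : K ⊆ 𝒳) :
    ∃ ω : ℝ → ℝ, ClassK ω ∧
      ∀ᵐ t : ℝ, 0 ≤ t → ∀ ξ ∈ K, ∀ ζ ∈ K, ‖g t ξ - g t ζ‖ ≤ ω ‖ξ - ζ‖ := by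
  obtain ⟨J, hJ1, hJ2, hJ3⟩ := h
  obtain ⟨ω, hω, hC⟩ := hJ3 K hK hK'
  refine ⟨ω, hω, ?_⟩
  have : ∀ᵐ t : ℝ, t ∉ Ici (0:ℝ) \ J := measure_eq_zero_iff_ae_notMem.1 hJ2
  filter_upwards [this] with t ht h0
  refine hC t ?_
  by_contra hcon
  exact ht ⟨h0, hcon⟩

theorem classK_tendsto {ω : ℝ → ℝ} (hω : ClassK ω) {ι : Type*} {l : Filter ι} {r : ι → ℝ}
    (hr0 : ∀ k, 0 ≤ r k) (hr : Tendsto r l (𝓝 0)) : Tendsto (fun k => ω (r k)) l (𝓝 0) := by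
  have h1 := hω.1 0 (mem_Ici.2 le_rfl)
  rw [ContinuousWithinAt, hω.2.2] at h1
  exact h1.comp (tendsto_nhdsWithin_iff.2 ⟨hr, Eventually.of_forall hr0⟩)

theorem contOn_of_classK {X F : Type*} [NormedAddCommGroup X] [NormedAddCommGroup F]
    {g : X → F} {K : Set X} {ω : ℝ → ℝ} (hω : ClassK ω)
    (h : ∀ ξ ∈ K, ∀ ζ ∈ K, ‖g ξ - g ζ‖ ≤ ω ‖ξ - ζ‖) : ContinuousOn g K := by
  intro ξ hξ
  rw [ContinuousWithinAt, tendsto_iff_norm_sub_tendsto_zero]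
  refine squeeze_zero' (g := fun ζ => ω ‖ζ - ξ‖) (Eventually.of_forall fun _ => norm_nonneg _)
    (by filter_upwards [self_mem_nhdsWithin] with ζ hζ using h ζ hζ ξ hξ) ?_
  refine classK_tendsto hω (fun _ => norm_nonneg _) ?_
  have : Tendsto (fun ζ : X => ζ) (𝓝[K] ξ) (𝓝 ξ) := tendsto_id.mono_left nhdsWithin_le_nhds
  exact tendsto_iff_norm_sub_tendsto_zero.1 this

theorem switching_measurable {N : ℕ} {σ : ℝ → Fin N} (h : IsSwitchingSignal σ) :
    Measurable σ := by
  have key : ∀ (k : ℕ) (τ : ℕ → ℝ), (∀ j, j < k → τ j < τ (j + 1)) →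
      (∀ j, j < k → ∀ s ∈ Ico (τ j) (τ (j + 1)), σ s = σ (τ j)) →
      ∀ i, MeasurableSet (σ ⁻¹' {i} ∩ Ico (τ 0) (τ k)) := by
    intro k τ h1 h2 i
    induction k with
    | zero => simp
    | succ k ih =>
      have ih' := ih (fun j hj => h1 j (by omega)) (fun j hj => h2 j (by omega))
      have hle : τ 0 ≤ τ k := by
        clear ih ih'
        have : ∀ m, m ≤ k → τ 0 ≤ τ m := by
          intro m
          induction m with
          | zero => intro _; exact le_rfl
          | succ m ihm => intro hm; exact (ihm (by omega)).trans (h1 m (by omega)).le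
        exact this k le_rfl
      rw [← Ico_union_Ico_eq_Ico hle (h1 k (by omega)).le, inter_union_distrib_left]
      refine ih'.union ?_
      by_cases hi : σ (τ k) = i
      · have : σ ⁻¹' {i} ∩ Ico (τ k) (τ (k + 1)) = Ico (τ k) (τ (k + 1)) := by
          refine inter_eq_right.2 fun s hs => ?_
          simp [h2 k (by omega) s hs, hi]
        rw [this]; exact measurableSet_Ico
      · have : σ ⁻¹' {i} ∩ Ico (τ k) (τ (k + 1)) = ∅ := by
          ext s
          simp only [mem_inter_iff, mem_preimage, mem_singleton_iff, mem_empty_iff_false, iff_false]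
          rintro ⟨hs1, hs⟩
          exact hi ((h2 k (by omega) s hs) ▸ hs1)
        rw [this]; exact MeasurableSet.empty
  refine measurable_to_countable' fun i => ?_
  have : σ ⁻¹' {i} = ⋃ m : ℕ, σ ⁻¹' {i} ∩ Ico (-(m:ℝ) - 1) (m + 1) := by
    rw [← inter_iUnion]
    refine (inter_eq_left.2 fun s _ => ?_).symm
    obtain ⟨m, hm⟩ := exists_nat_ge |s|
    rw [mem_iUnion]
    have := abs_le.1 hm
    exact ⟨m, by constructor <;> linarith⟩
  rw [this]
  refine MeasurableSet.iUnion fun m => ?_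
  obtain ⟨k, τ, h0, hk, h1, h2⟩ := h (-(m:ℝ) - 1) (m + 1) (by
    have : (0:ℝ) ≤ m := Nat.cast_nonneg m
    linarith)
  have := key k τ h1 h2 i
  rwa [h0, hk] at this

theorem aesm_switched {N : ℕ} {F : Type*} [NormedAddCommGroup F] (g : Fin N → ℝ → F)
    (μ : Measure ℝ) (hg : ∀ i, AEStronglyMeasurable (g i) μ) (σ : ℝ → Fin N) (hσ : Measurable σ) :
    AEStronglyMeasurable (fun t => g (σ t) t) μ := by
  classical
  have : (fun t => g (σ t) t) = fun t => ∑ i, (σ ⁻¹' {i}).indicator (g i) t := by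
    ext t
    rw [Finset.sum_eq_single (σ t)]
    · rw [indicator_of_mem]; simp
    · intro b _ hb
      rw [indicator_of_notMem]
      simpa using hb.symm
    · simp
  rw [this]
  exact Finset.aestronglyMeasurable_fun_sum _ fun i _ =>
    (hg i).indicator (hσ (measurableSet_singleton i))

section SolLemmas

variable {n N : ℕ} {𝒳 : Set (E n)} {f : ℝ → E n → Fin N → E n}

theorem sol_continuousOn (T : Sol 𝒳 f) {a b : ℝ} (ha : T.t0 ≤ a) (hab : a ≤ b)
    (hb : (b : EReal) < T.tf) : ContinuousOn T.x (Icc a b) := by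
  have h := intervalIntegral.continuousOn_primitive_interval'
    (T.intg a b ha hab hb) (left_mem_uIcc)
  rw [uIcc_of_le hab] at h
  refine (continuousOn_const (c := T.x a)).add h |>.congr fun t ht => ?_
  exact T.sol a t ha ht.1 (lt_of_le_of_lt (by exact_mod_cast ht.2) hb)

theorem sol_bound (T : Sol 𝒳 f) (K : Set (E n)) (C : ℝ)
    (hC : ∀ᵐ t : ℝ, 0 ≤ t → ∀ i, ∀ ξ ∈ K, ‖f t ξ i‖ ≤ C)
    {a b : ℝ} (ha : T.t0 ≤ a) (hab : a ≤ b)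
    (hb : (b : EReal) < T.tf) (hx : ∀ t ∈ Icc a b, T.x t ∈ K) :
    ‖T.x b - T.x a‖ ≤ C * (b - a) := by
  rw [T.sol a b ha hab hb, add_sub_cancel_left]
  rw [← abs_of_nonneg (sub_nonneg.2 hab)]
  refine intervalIntegral.norm_integral_le_of_norm_le_const_ae ?_
  filter_upwards [hC] with t ht ht2
  rw [uIoc_of_le hab] at ht2
  exact ht ((T.t0_nonneg.trans ha).trans ht2.1.le) _ _ (hx t ⟨ht2.1.le, ht2.2⟩)

theorem sol_lyap (hXopen : IsOpen 𝒳)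
    (hf_bdd : ∀ i, UnifBounded 𝒳 fun t ξ => f t ξ i)
    (Vb : ℝ → E n → ℝ)
    (hV_smooth : ContDiffOn ℝ 1 (fun q : ℝ × E n => Vb q.1 q.2) (Ici (0:ℝ) ×ˢ 𝒳))
    (η : Fin N → ℝ → E n → ℝ)
    (hη_meas : ∀ i ξ, Measurable fun t => η i t ξ)
    (hη_cont : ∀ i, ∀ᵐ t ∂(volume.restrict (Ici (0:ℝ))), ContinuousOn (η i t) 𝒳)
    (hV_decrease : ∀ i : Fin N, ∀ t : ℝ, 0 ≤ t → ∀ ξ ∈ 𝒳,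
      ∀ D : ℝ × E n →L[ℝ] ℝ,
        HasFDerivWithinAt (fun q : ℝ × E n => Vb q.1 q.2) D (Ici (0:ℝ) ×ˢ 𝒳) (t, ξ) →
        D (1, f t ξ i) ≤ -(η i t ξ))
    (hη_bdd : ∀ i, UnifBounded 𝒳 (η i))
    (T : Sol 𝒳 f) {a b : ℝ} (ha : T.t0 ≤ a) (hab : a ≤ b)
    (hb : (b : EReal) < T.tf) :
    IntervalIntegrable (fun t => η (T.σ t) t (T.x t)) volume a b ∧
    Vb b (T.x b) + ∫ t in a..b, η (T.σ t) t (T.x t) ≤ Vb a (T.x a) := by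
  have ha0 : 0 ≤ a := T.t0_nonneg.trans ha
  have hcont := sol_continuousOn T ha hab hb
  have hmem : ∀ t ∈ Icc a b, T.x t ∈ 𝒳 := fun t ht =>
    T.mem t (ha.trans ht.1) (lt_of_le_of_lt (by exact_mod_cast ht.2) hb)
  set K := T.x '' Icc a b with hKdef
  have hK : IsCompact K := isCompact_Icc.image_of_continuousOn hcont
  have hK' : K ⊆ 𝒳 := by rintro _ ⟨t, ht, rfl⟩; exact hmem t ht
  have hxK : ∀ t ∈ Icc a b, T.x t ∈ K := fun t ht => ⟨t, ht, rfl⟩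
  obtain ⟨C, hC0, hC⟩ := unifBounded_all (fun i t ξ => f t ξ i) hf_bdd K hK hK'
  obtain ⟨C', hC'0, hC'⟩ := unifBounded_all η hη_bdd K hK hK'
  -- integrability of the output
  have hint : IntervalIntegrable (fun t => η (T.σ t) t (T.x t)) volume a b := by
    rw [intervalIntegrable_iff_integrableOn_Icc_of_le hab]
    have hm : AEStronglyMeasurable (fun t => η (T.σ t) t (T.x t)) (volume.restrict (Icc a b)) := by
      let y : ℝ → E n := fun t => T.x (projIcc a b hab t)
      have hy : Continuous y := by
        have := continuousOn_iff_continuous_domRestrict.1 hcont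
        exact this.comp continuous_projIcc
      have h1 : AEStronglyMeasurable (fun t => η (T.σ t) t (y t)) (volume.restrict (Icc a b)) := by
        refine aesm_switched (fun i t => η i t (y t)) _ (fun i => ?_) T.σ
          (switching_measurable T.switching)
        refine aesm_carath 𝒳 (η i) (fun ξ _ => (hη_meas i ξ).stronglyMeasurable) _ ?_ y
          hy.measurable (fun t => hmem _ (projIcc a b hab t).2)
        exact ae_mono (Measure.restrict_mono (fun t ht => ha0.trans ht.1) le_rfl) (hη_cont i)
      refine h1.congr ?_
      filter_upwards [ae_restrict_mem measurableSet_Icc] with t ht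
      simp only [y, projIcc_of_mem hab ht]
    refine Integrable.mono' (g := fun _ => C') (integrableOn_const measure_Icc_lt_top.ne) hm ?_
    filter_upwards [ae_restrict_of_ae hC', ae_restrict_mem measurableSet_Icc] with t h1 h2
    exact h1 (ha0.trans h2.1) _ _ (hxK t h2)
  refine ⟨hint, ?_⟩
  rcases eq_or_lt_of_le hab with rfl | hlt
  · simp
  -- Lipschitz continuity
  have hxlip : LipschitzOnWith ⟨C, hC0⟩ T.x (Icc a b) := by
    refine LipschitzOnWith.of_dist_le_mul ?_
    have key : ∀ s ∈ Icc a b, ∀ t ∈ Icc a b, s ≤ t → dist (T.x s) (T.x t) ≤ C * dist s t := by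
      intro s hs t ht hst
      rw [dist_comm, dist_eq_norm, dist_comm s, Real.dist_eq, abs_of_nonneg (sub_nonneg.2 hst)]
      exact sol_bound T K C hC (ha.trans hs.1) hst (lt_of_le_of_lt (by exact_mod_cast ht.2) hb)
        fun r hr => hxK r ⟨hs.1.trans hr.1, hr.2.trans ht.2⟩
    intro s hs t ht
    rcases le_total s t with h | h
    · exact key s hs t ht h
    · rw [dist_comm, dist_comm s]; exact key t ht s hs h
  have hVloc : LocallyLipschitzOn (Ici (0:ℝ) ×ˢ 𝒳) (fun q : ℝ × E n => Vb q.1 q.2) := by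
    rintro ⟨t, ξ⟩ ⟨ht, hξ⟩
    obtain ⟨ε, hε, hball⟩ := Metric.isOpen_iff.1 hXopen ξ hξ
    have hsub : Ici (0:ℝ) ×ˢ Metric.ball ξ ε ⊆ Ici (0:ℝ) ×ˢ 𝒳 := prod_mono le_rfl hball
    have h1 : ContDiffWithinAt ℝ 1 (fun q : ℝ × E n => Vb q.1 q.2)
        (Ici (0:ℝ) ×ˢ Metric.ball ξ ε) (t, ξ) := (hV_smooth (t, ξ) ⟨ht, hξ⟩).mono hsub
    obtain ⟨L, u, hu, hL⟩ := h1.exists_lipschitzOnWith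
      ((convex_Ici 0).prod (convex_ball ξ ε))
    refine ⟨L, u, ?_, hL⟩
    have : 𝓝[Ici (0:ℝ) ×ˢ Metric.ball ξ ε] (t, ξ) = 𝓝[Ici (0:ℝ) ×ˢ 𝒳] (t, ξ) := by
      rw [nhdsWithin_prod_eq, nhdsWithin_prod_eq,
        (Metric.isOpen_ball).nhdsWithin_eq (Metric.mem_ball_self hε), hXopen.nhdsWithin_eq hξ]
    rwa [← this]
  obtain ⟨L, hL⟩ := (hVloc.mono (prod_mono (fun t ht => ha0.trans ht.1) hK' :
    Icc a b ×ˢ K ⊆ _)).exists_lipschitzOnWith_of_compact (isCompact_Icc.prod hK)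
  set W : ℝ → ℝ := fun t => Vb t (T.x t) with hW
  have hWlip : LipschitzOnWith (L * max 1 ⟨C, hC0⟩) W (Icc a b) := by
    have h1 : LipschitzOnWith (max 1 ⟨C, hC0⟩) (fun t => (t, T.x t)) (Icc a b) :=
      (LipschitzWith.id.lipschitzOnWith).prodMk hxlip
    exact hL.comp h1 (fun t ht => ⟨ht, hxK t ht⟩)
  have hAC : AbsolutelyContinuousOnInterval W a b :=
    LipschitzOnWith.absolutelyContinuousOnInterval (by rw [uIcc_of_le hab]; exact hWlip)
  have hFTC := hAC.integral_deriv_eq_sub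
  have hder : ∀ᵐ t : ℝ, t ∈ Ioo a b → deriv W t ≤ -(η (T.σ t) t (T.x t)) := by
    filter_upwards [(T.intg a b ha hab hb).ae_hasDerivAt_integral] with t ht1 ht
    have htI : t ∈ Icc a b := ⟨ht.1.le, ht.2.le⟩
    have h1 := ht1 (by rw [uIcc_of_le hab]; exact htI) a left_mem_uIcc
    have h2 : HasDerivAt T.x (f t (T.x t) (T.σ t)) t := by
      have h3 := h1.const_add (T.x a)
      refine h3.congr_of_eventuallyEq ?_
      filter_upwards [Ioo_mem_nhds ht.1 ht.2] with s hs
      exact T.sol a s ha hs.1.le (lt_trans (by exact_mod_cast hs.2) hb)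
    have h4 : HasDerivAt (fun s => (s, T.x s)) ((1:ℝ), f t (T.x t) (T.σ t)) t :=
      (hasDerivAt_id t).prodMk h2
    have ht0 : 0 < t := lt_of_le_of_lt ha0 ht.1
    have hd := ((hV_smooth (t, T.x t) ⟨ht0.le, hmem t htI⟩).differentiableWithinAt
      (by norm_num)).hasFDerivWithinAt
    have hdec := hV_decrease (T.σ t) t ht0.le _ (hmem t htI) _ hd
    have hd' := hd.hasFDerivAt (prod_mem_nhds (Ici_mem_nhds ht0) (hXopen.mem_nhds (hmem t htI)))
    have h5 := HasFDerivAt.comp_hasDerivAt (f := fun s => (s, T.x s)) t hd' h4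
    have h6 : HasDerivAt W _ t := h5
    rw [h6.deriv]
    exact hdec
  have hder' : deriv W ≤ᵐ[volume.restrict (Icc a b)] fun t => -(η (T.σ t) t (T.x t)) := by
    rw [EventuallyLE, ae_restrict_iff' measurableSet_Icc]
    have e1 : ∀ᵐ t : ℝ, t ≠ a := by simp [ae_iff]
    have e2 : ∀ᵐ t : ℝ, t ≠ b := by simp [ae_iff]
    filter_upwards [hder, e1, e2] with t h1 h2 h3 h4
    exact h1 ⟨lt_of_le_of_ne h4.1 h2.symm, lt_of_le_of_ne h4.2 h3⟩
  have hmono := intervalIntegral.integral_mono_ae_restrict hab hAC.intervalIntegrable_deriv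
    hint.neg hder'
  simp only [Pi.neg_apply] at hmono
  rw [hFTC, intervalIntegral.integral_neg] at hmono
  simp only [hW] at hmono
  linarith

end SolLemmas


theorem ae_shift {P : ℝ → Prop} (h : ∀ᵐ t : ℝ, P t) (c : ℝ) : ∀ᵐ s : ℝ, P (c + s) :=
  (measurePreserving_add_left volume c).quasiMeasurePreserving.ae h

/-- Passing to the limit in switched integrals. -/
theorem switched_integral_limit {N : ℕ} (w : ℕ → ℝ → Fin N) (hw : ∀ k, Measurable (w k))
    (u : ℝ → Fin N → ℝ)
    (hu : IsControl u)
    (hwu : ∀ i, ∀ g : ℝ → ℝ, AEStronglyMeasurable g volume → (∃ C, ∀ᵐ s, |g s| ≤ C) →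
        (∃ M, ∀ s, M < |s| → g s = 0) →
        Tendsto (fun k => ∫ s, (if w k s = i then 1 else 0) * g s) atTop
          (𝓝 (∫ s, u s i * g s)))
    (S : Set ℝ) (hS : MeasurableSet S) (M : ℝ) (hSM : S ⊆ Icc (-M) M)
    (q : ℕ → Fin N → ℝ → ℝ) (ql : Fin N → ℝ → ℝ) (C : ℝ) (k0 : ℕ)
    (hm : ∀ k ≥ k0, ∀ i, AEStronglyMeasurable (q k i) (volume.restrict S))
    (hb : ∀ k ≥ k0, ∀ i, ∀ᵐ s ∂(volume.restrict S), |q k i s| ≤ C)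
    (hl : ∀ i, ∀ᵐ s ∂(volume.restrict S), Tendsto (fun k => q k i s) atTop (𝓝 (ql i s))) :
    (∀ i, AEStronglyMeasurable (ql i) (volume.restrict S)) ∧
    (∀ i, ∀ᵐ s ∂(volume.restrict S), |ql i s| ≤ C) ∧
    Tendsto (fun k => ∫ s in S, q k (w k s) s) atTop (𝓝 (∫ s in S, ∑ i, u s i * ql i s)) := by
  classical
  have hfin : volume S < ⊤ := lt_of_le_of_lt (measure_mono hSM) measure_Icc_lt_top
  have : IsFiniteMeasure (volume.restrict S) := ⟨by simpa using hfin⟩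
  have hqm : ∀ i, AEStronglyMeasurable (ql i) (volume.restrict S) := by
    intro i
    refine aestronglyMeasurable_of_tendsto_ae atTop (f := fun k => q (k + k0) i)
      (fun k => hm _ (by omega) i) ?_
    filter_upwards [hl i] with s hs
    exact hs.comp (tendsto_add_atTop_nat k0)
  have hbk : ∀ i, ∀ᵐ s ∂(volume.restrict S), ∀ k ≥ k0, |q k i s| ≤ C := by
    intro i
    rw [ae_all_iff]
    intro k
    by_cases hk : k ≥ k0
    · filter_upwards [hb k hk i] with s hs _ using hs
    · exact ae_of_all _ fun s h => absurd h hk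
  have hqb : ∀ i, ∀ᵐ s ∂(volume.restrict S), |ql i s| ≤ C := by
    intro i
    filter_upwards [hl i, hbk i] with s h1 h2
    exact le_of_tendsto h1.abs (eventually_atTop.2 ⟨k0, h2⟩)
  refine ⟨hqm, hqb, ?_⟩
  have hqi : ∀ i, Integrable (ql i) (volume.restrict S) := fun i =>
    Integrable.mono' (integrable_const C) (hqm i) (hqb i)
  have hum : ∀ i, Measurable fun s => u s i := fun i => (measurable_pi_apply i).comp hu.1
  have hu01 : ∀ s i, |u s i| ≤ 1 := by
    intro s i
    rw [abs_of_nonneg ((hu.2 s).1 i), ← (hu.2 s).2]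
    exact Finset.single_le_sum (f := u s) (fun j _ => (hu.2 s).1 j) (Finset.mem_univ i)
  -- second part
  have hB : Tendsto (fun k => ∫ s in S, ql (w k s) s) atTop
      (𝓝 (∫ s in S, ∑ i, u s i * ql i s)) := by
    have h1 : ∀ i, Tendsto (fun k => ∫ s in S, (if w k s = i then (1:ℝ) else 0) * ql i s) atTop
        (𝓝 (∫ s in S, u s i * ql i s)) := by
      intro i
      have := hwu i (S.indicator (ql i)) ((aestronglyMeasurable_indicator_iff hS).2 (hqm i))
        ⟨|C|, by
          have := (ae_restrict_iff' hS).1 (hqb i)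
          filter_upwards [this] with s hs
          by_cases h : s ∈ S
          · rw [indicator_of_mem h]; exact (hs h).trans (le_abs_self _)
          · rw [indicator_of_notMem h]; simp⟩
        ⟨M, fun s hs => by
          rw [indicator_of_notMem]
          intro h
          exact absurd (abs_le.2 (hSM h)) (not_le.2 hs)⟩
      convert this using 2
      · rw [← integral_indicator hS]
        congr 1; ext s
        by_cases h : s ∈ S
        · rw [indicator_of_mem h, indicator_of_mem h]
        · rw [indicator_of_notMem h, indicator_of_notMem h, mul_zero]
      · rw [← integral_indicator hS]
        congr 2; ext s
        by_cases h : s ∈ S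
        · rw [indicator_of_mem h, indicator_of_mem h]
        · rw [indicator_of_notMem h, indicator_of_notMem h, mul_zero]
    have h2 := tendsto_finsetSum (Finset.univ : Finset (Fin N)) fun i _ => h1 i
    have e2 : ∫ s in S, ∑ i, u s i * ql i s = ∑ i, ∫ s in S, u s i * ql i s := by
      refine integral_finsetSum _ fun i _ => ?_
      exact (hqi i).bdd_mul (c := 1) (hum i).aestronglyMeasurable (ae_of_all _ fun s => hu01 s i)
    rw [e2]
    refine h2.congr fun k => ?_
    rw [← integral_finsetSum]
    · simp
    · intro i _
      refine (hqi i).bdd_mul (c := 1) ?_ (ae_of_all _ fun s => ?_)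
      · exact (Measurable.ite (hw k (measurableSet_singleton i)) measurable_const
          measurable_const).aestronglyMeasurable
      · split_ifs <;> simp
  have hA : Tendsto (fun k => ∫ s in S, (q k (w k s) s - ql (w k s) s)) atTop (𝓝 0) := by
    have := tendsto_integral_filter_of_dominated_convergence (l := atTop)
      (F := fun k s => q k (w k s) s - ql (w k s) s) (f := fun _ => (0:ℝ))
      (μ := volume.restrict S) (fun _ => 2 * C) ?_ ?_ (integrable_const _) ?_
    · simpa using this
    · filter_upwards [eventually_ge_atTop k0] with k hk
      exact (aesm_switched (q k) _ (hm k hk) _ (hw k)).sub (aesm_switched ql _ hqm _ (hw k))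
    · filter_upwards [eventually_ge_atTop k0] with k hk
      filter_upwards [ae_all_iff.2 (hb k hk), ae_all_iff.2 hqb] with s h1 h2
      have := norm_sub_le (q k (w k s) s) (ql (w k s) s)
      have h3 := h1 (w k s)
      have h4 := h2 (w k s)
      simp only [Real.norm_eq_abs] at this ⊢
      linarith
    · filter_upwards [ae_all_iff.2 hl] with s hs
      have h0 : Tendsto (fun k => ∑ i, |q k i s - ql i s|) atTop (𝓝 0) := by
        have := tendsto_finsetSum (Finset.univ : Finset (Fin N)) fun i _ =>
          ((hs i).sub_const (ql i s)).abs
        simpa using this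
      refine squeeze_zero_norm (fun k => ?_) h0
      exact Finset.single_le_sum (f := fun i => |q k i s - ql i s|) (fun _ _ => abs_nonneg _)
        (Finset.mem_univ (w k s))
  have hAB := hA.add hB
  rw [zero_add] at hAB
  refine hAB.congr' ?_
  filter_upwards [eventually_ge_atTop k0] with k hk
  have i1 : Integrable (fun s => q k (w k s) s) (volume.restrict S) := by
    refine Integrable.mono' (integrable_const C) (aesm_switched (q k) _ (hm k hk) _ (hw k)) ?_
    filter_upwards [ae_all_iff.2 (hb k hk)] with s h1 using h1 _
  have i2 : Integrable (fun s => ql (w k s) s) (volume.restrict S) := by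
    refine Integrable.mono' (integrable_const C) (aesm_switched ql _ hqm _ (hw k)) ?_
    filter_upwards [ae_all_iff.2 hqb] with s h1 using h1 _
  rw [integral_sub i1 i2]
  ring

theorem zeroing_switched {N : ℕ} {X : Type*} [NormedAddCommGroup X] {G : Type*}
    [NormedAddCommGroup G] {𝒳 : Set X} (η : Fin N → ℝ → X → ℝ) (Δ : ℝ → X → Fin N → G)
    (hzp : ∀ i, ZeroingPair 𝒳 (η i) fun t ξ => Δ t ξ i)
    (K : Set X) (hK : IsCompact K) (hK' : K ⊆ 𝒳) (δ : ℝ) (hδ : 0 < δ)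
    (τ : ℕ → ℝ) (hτ : Tendsto τ atTop atTop) (v : ℕ → X) (hv : ∀ k, v k ∈ K)
    (hvδ : ∀ k, δ ≤ ‖v k‖) (i : ℕ → Fin N)
    (h0 : Tendsto (fun k => η (i k) (τ k) (v k)) atTop (𝓝 0)) :
    Tendsto (fun k => Δ (τ k) (v k) (i k)) atTop (𝓝 0) := by
  refine tendsto_of_subseq_tendsto fun ns hns => ?_
  obtain ⟨j, hj⟩ : ∃ j, ∃ᶠ k in atTop, i (ns k) = j := by
    by_contra hcon
    push Not at hcon
    have := eventually_all.2 hcon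
    obtain ⟨k, hk⟩ := this.exists
    exact hk (i (ns k)) rfl
  obtain ⟨ms, hms, hms'⟩ := extraction_of_frequently_atTop hj
  have ht : Tendsto (fun k => ns (ms k)) atTop atTop := hns.comp hms.tendsto_atTop
  refine ⟨ms, ?_⟩
  have := hzp j (fun k => τ (ns (ms k))) (hτ.comp ht) K hK hK' δ hδ (fun k => v (ns (ms k)))
    (fun k => hv _) (fun k => hvδ _) ((h0.comp ht).congr fun k => by
      simp only [Function.comp]; rw [hms'])
  refine this.congr fun k => ?_
  rw [hms']

theorem family_limit {n : ℕ} {F : Type*} [NormedAddCommGroup F]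
    {𝒳 : Set (E n)} (g : ℝ → E n → F) (gl : ℝ → E n → F)
    (hg : ContXiUnifT 𝒳 g) (hgm : ∀ ξ ∈ 𝒳, StronglyMeasurable fun t => g t ξ)
    (K : Set (E n)) (hK : IsCompact K) (hK' : K ⊆ 𝒳)
    (t : ℕ → ℝ) (ht : Tendsto t atTop atTop) (hgl : IsLimitAlong 𝒳 g t gl)
    (y : ℕ → ℝ → E n) (hy : ∀ k, Measurable (y k)) (hyK : ∀ k s, y k s ∈ K)
    (x : ℝ → E n) (hxK : ∀ s, x s ∈ K) (hx : ∀ s, Tendsto (fun k => y k s) atTop (𝓝 (x s))) :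
    (∀ k, ∀ S, MeasurableSet S → (∀ s ∈ S, 0 ≤ t k + s) →
      AEStronglyMeasurable (fun s => g (t k + s) (y k s)) (volume.restrict S)) ∧
    ∀ᵐ s, Tendsto (fun k => g (t k + s) (y k s)) atTop (𝓝 (gl s (x s))) := by
  obtain ⟨ω, hω, hωc⟩ := contXi_ae g hg K hK hK'
  constructor
  · intro k S hS hS0
    refine aesm_carath K (fun s ξ => g (t k + s) ξ) (fun ξ hξ => ?_) _ ?_ (y k) (hy k) (hyK k)
    · exact (hgm ξ (hK' hξ)).comp_measurable (measurable_const_add (t k))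
    · rw [ae_restrict_iff' hS]
      filter_upwards [ae_shift hωc (t k)] with s hs hsS
      exact contOn_of_classK hω (hs (hS0 s hsS))
  · obtain ⟨Z, hZ, hZl⟩ := hgl
    have h1 : ∀ᵐ s, ∀ k, 0 ≤ t k + s → ∀ ξ ∈ K, ∀ ζ ∈ K,
        ‖g (t k + s) ξ - g (t k + s) ζ‖ ≤ ω ‖ξ - ζ‖ :=
      ae_all_iff.2 fun k => ae_shift hωc (t k)
    filter_upwards [h1, measure_eq_zero_iff_ae_notMem.1 hZ] with s hs hsZ
    have h2 := hZl (x s) (hK' (hxK s)) s hsZ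
    have h3 : Tendsto (fun k => g (t k + s) (y k s) - g (t k + s) (x s)) atTop (𝓝 0) := by
      rw [tendsto_zero_iff_norm_tendsto_zero]
      have h4 : Tendsto (fun k => ω ‖y k s - x s‖) atTop (𝓝 0) :=
        classK_tendsto hω (fun _ => norm_nonneg _) (tendsto_iff_norm_sub_tendsto_zero.1 (hx s))
      refine squeeze_zero' (Eventually.of_forall fun _ => norm_nonneg _) ?_ h4
      filter_upwards [ht.eventually_ge_atTop (-s)] with k hk
      exact hs k (by linarith) _ (hyK k s) _ (hxK s)
    have := h3.add h2
    simpa using this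


theorem core0 {n N : ℕ} {𝒳 : Set (E n)}
    (f fhat Δf : ℝ → E n → Fin N → E n)
    (hdecomp : ∀ t ξ i, f t ξ i = fhat t ξ i + Δf t ξ i)
    (hf_bdd : ∀ i, UnifBounded 𝒳 fun t ξ => f t ξ i)
    (η : Fin N → ℝ → E n → ℝ) (hη_nonneg : ∀ i t ξ, 0 ≤ η i t ξ)
    (hη_meas : ∀ i ξ, Measurable fun t => η i t ξ)
    (hη_bdd : ∀ i, UnifBounded 𝒳 (η i))
    (hη_contu : ∀ i, ContXiUnifT 𝒳 (η i))
    (hfhat_bdd : ∀ i, UnifBounded 𝒳 fun t ξ => fhat t ξ i)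
    (hfhat_meas : ∀ i, ∀ ξ ∈ 𝒳, Measurable fun t => fhat t ξ i)
    (hfhat_cont : ∀ i, ContXiUnifT 𝒳 fun t ξ => fhat t ξ i)
    (hzp : ∀ i, ZeroingPair 𝒳 (η i) fun t ξ => Δf t ξ i)
    (hred : ∀ γ : ℕ → ℝ, Tendsto γ atTop atTop →
      ∀ (fl : Fin N → ℝ → E n → E n) (hlm : Fin N → ℝ → E n → ℝ),
        (∀ i, IsLimitAlong 𝒳 (fun t ξ => fhat t ξ i) γ (fl i)) →
        (∀ i, IsLimitAlong 𝒳 (η i) γ (hlm i)) →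
        ∀ (x : ℝ → E n) (u : ℝ → Fin N → ℝ),
          (∀ t, x t ∈ 𝒳) → LocAC x → IsControl u →
          (∀ᵐ t : ℝ, HasDerivAt x (∑ i, u t i • fl i t (x t)) t ∧
            ∑ i, u t i * ‖hlm i t (x t)‖ = 0) →
          BoundedRange 𝒳 x →
          (⨅ t : ℝ, ‖x t‖) = 0)
    (K : Set (E n)) (hK : IsCompact K) (hK' : K ⊆ 𝒳) (δ : ℝ) (hδ : 0 < δ)
    (t : ℕ → ℝ) (htk : ∀ k : ℕ, (k : ℝ) ≤ t k)
    (y : ℕ → ℝ → E n) (L : NNReal) (hL : ∀ k, LipschitzWith L (y k))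
    (hyK : ∀ k s, y k s ∈ K) (hyδ : ∀ k s, δ ≤ ‖y k s‖)
    (w : ℕ → ℝ → Fin N) (hw : ∀ k, Measurable (w k))
    (hint : ∀ (k : ℕ) (a b : ℝ), -(k:ℝ) ≤ a → a ≤ b → b ≤ k →
      IntervalIntegrable (fun s => f (t k + s) (y k s) (w k s)) volume a b ∧
      y k b - y k a = ∫ s in a..b, f (t k + s) (y k s) (w k s))
    (h0 : ∀ᵐ s, Tendsto (fun k => η (w k s) (t k + s) (y k s)) atTop (𝓝 0))
    (x : ℝ → E n) (hx : ∀ s, Tendsto (fun k => y k s) atTop (𝓝 (x s)))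
    (fl : Fin N → ℝ → E n → E n) (hlm : Fin N → ℝ → E n → ℝ)
    (hfl : ∀ i, IsLimitAlong 𝒳 (fun t ξ => fhat t ξ i) t (fl i))
    (hhl : ∀ i, IsLimitAlong 𝒳 (η i) t (hlm i))
    (u : ℝ → Fin N → ℝ) (hu : IsControl u)
    (hwu : ∀ i, ∀ g : ℝ → ℝ, AEStronglyMeasurable g volume → (∃ C, ∀ᵐ s, |g s| ≤ C) →
        (∃ M, ∀ s, M < |s| → g s = 0) →
        Tendsto (fun k => ∫ s, (if w k s = i then 1 else 0) * g s) atTop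
          (𝓝 (∫ s, u s i * g s))) : False := by
  have ht : Tendsto t atTop atTop := tendsto_atTop_mono htk tendsto_natCast_atTop_atTop
  have hxK : ∀ s, x s ∈ K := fun s =>
    hK.isClosed.mem_of_tendsto (hx s) (Eventually.of_forall fun k => hyK k s)
  have hxδ : ∀ s, δ ≤ ‖x s‖ := fun s =>
    ge_of_tendsto (hx s).norm (Eventually.of_forall fun k => hyδ k s)
  have hym : ∀ k, Measurable (y k) := fun k => (hL k).continuous.measurable
  obtain ⟨Cf, hCf0, hCf⟩ := unifBounded_all (fun i t ξ => f t ξ i) hf_bdd K hK hK'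
  obtain ⟨Ch, hCh0, hCh⟩ := unifBounded_all (fun i t ξ => fhat t ξ i) hfhat_bdd K hK hK'
  obtain ⟨Ce, hCe0, hCe⟩ := unifBounded_all η hη_bdd K hK hK'
  have hF := fun i => family_limit (fun t ξ => fhat t ξ i) (fl i) (hfhat_cont i)
    (fun ξ hξ => (hfhat_meas i ξ hξ).stronglyMeasurable) K hK hK' t ht (hfl i) y hym hyK x hxK hx
  have hH := fun i => family_limit (η i) (hlm i) (hη_contu i)
    (fun ξ _ => (hη_meas i ξ).stronglyMeasurable) K hK hK' t ht (hhl i) y hym hyK x hxK hx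
  have hCf' : ∀ᵐ s, ∀ k, 0 ≤ t k + s → ∀ i, ‖f (t k + s) (y k s) i‖ ≤ Cf :=
    ae_all_iff.2 fun k => (ae_shift hCf (t k)).mono fun s hs h i => hs h i _ (hyK k s)
  have hCh' : ∀ᵐ s, ∀ k, 0 ≤ t k + s → ∀ i, ‖fhat (t k + s) (y k s) i‖ ≤ Ch :=
    ae_all_iff.2 fun k => (ae_shift hCh (t k)).mono fun s hs h i => hs h i _ (hyK k s)
  have hCe' : ∀ᵐ s, ∀ k, 0 ≤ t k + s → ∀ i, ‖η i (t k + s) (y k s)‖ ≤ Ce :=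
    ae_all_iff.2 fun k => (ae_shift hCe (t k)).mono fun s hs h i => hs h i _ (hyK k s)
  have hΔ : ∀ᵐ s, Tendsto (fun k => Δf (t k + s) (y k s) (w k s)) atTop (𝓝 0) := by
    filter_upwards [h0] with s hs
    exact zeroing_switched η Δf hzp K hK hK' δ hδ (fun k => t k + s)
      (tendsto_atTop_add_const_right _ s ht) (fun k => y k s) (fun k => hyK k s)
      (fun k => hyδ k s) (fun k => w k s) hs
  set G : ℝ → E n := fun s => ∑ i, u s i • fl i s (x s) with hG
  have hum : ∀ i, Measurable fun s => u s i := fun i => (measurable_pi_apply i).comp hu.1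
  -- choosing k0
  have hk0 : ∀ M : ℝ, ∃ k0 : ℕ, ∀ k ≥ k0, M ≤ k := fun M => by
    obtain ⟨k0, hk0⟩ := exists_nat_ge M
    exact ⟨k0, fun k hk => hk0.trans (by exact_mod_cast hk)⟩
  have hposS : ∀ M : ℝ, ∀ k : ℕ, M ≤ k → ∀ s ∈ Icc (-M) M, 0 ≤ t k + s := fun M k hk s hs => by
    have := htk k; have := hs.1; linarith
  -- integrability of G
  have hGm : ∀ M : ℝ, AEStronglyMeasurable G (volume.restrict (Icc (-M) M)) := by
    intro M
    obtain ⟨k0, hk0⟩ := hk0 M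
    refine Finset.aestronglyMeasurable_fun_sum _ fun i _ => ?_
    refine (hum i).aestronglyMeasurable.smul ?_
    refine aestronglyMeasurable_of_tendsto_ae atTop
      (f := fun k s => fhat (t (k + k0) + s) (y (k + k0) s) i)
      (fun k => (hF i).1 (k + k0) _ measurableSet_Icc (hposS M _ (hk0 _ (by omega)))) ?_
    filter_upwards [ae_restrict_of_ae (hF i).2] with s hs
    exact hs.comp (tendsto_add_atTop_nat k0)
  have hGb : ∀ᵐ s, ‖G s‖ ≤ Ch := by
    filter_upwards [hCh', ae_all_iff.2 fun i => (hF i).2] with s h1 h2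
    have h3 : ∀ i, ‖fl i s (x s)‖ ≤ Ch := fun i => by
      refine le_of_tendsto (h2 i).norm ?_
      filter_upwards [ht.eventually_ge_atTop (-s)] with k hk
      exact h1 k (by linarith) i
    calc ‖G s‖ ≤ ∑ i, ‖u s i • fl i s (x s)‖ := norm_sum_le _ _
      _ ≤ ∑ i, u s i * Ch := Finset.sum_le_sum fun i _ => by
          rw [norm_smul, Real.norm_of_nonneg ((hu.2 s).1 i)]
          exact mul_le_mul_of_nonneg_left (h3 i) ((hu.2 s).1 i)
      _ = Ch := by rw [← Finset.sum_mul, (hu.2 s).2, one_mul]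
  have hGiM : ∀ M : ℝ, IntegrableOn G (Icc (-M) M) volume := fun M =>
    Integrable.mono' (g := fun _ => Ch) (integrableOn_const measure_Icc_lt_top.ne) (hGm M)
      (ae_restrict_of_ae hGb)
  have hsubM : ∀ a b : ℝ, Icc a b ⊆ Icc (-(max |a| |b|)) (max |a| |b|) := fun a b s hs =>
    ⟨by have := neg_abs_le a; have := le_max_left |a| |b|; linarith [hs.1],
     hs.2.trans ((le_abs_self b).trans (le_max_right _ _))⟩
  have hGi : ∀ a b : ℝ, a ≤ b → IntervalIntegrable G volume a b := fun a b hab =>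
    (intervalIntegrable_iff_integrableOn_Icc_of_le hab).2 ((hGiM _).mono_set (hsubM a b))
  have hGi' : ∀ a b : ℝ, IntervalIntegrable G volume a b := fun a b => by
    rcases le_total a b with h | h
    · exact hGi a b h
    · exact (hGi b a h).symm
  have hkey : ∀ a b : ℝ, a ≤ b → x b - x a = ∫ s in a..b, G s := by
    intro a b hab
    set M := max |a| |b| with hM
    obtain ⟨k0, hk0⟩ := hk0 M
    have hSM : Ioc a b ⊆ Icc (-M) M := Ioc_subset_Icc_self.trans (hsubM a b)
    have hpos : ∀ k ≥ k0, ∀ s ∈ Ioc a b, 0 ≤ t k + s := fun k hk s hs =>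
      hposS M k (hk0 k hk) s (hSM hs)
    have hfin : IsFiniteMeasure (volume.restrict (Ioc a b)) := ⟨by simp⟩
    have hFm : ∀ k ≥ k0, AEStronglyMeasurable (fun s => fhat (t k + s) (y k s) (w k s))
        (volume.restrict (Ioc a b)) := fun k hk =>
      aesm_switched (fun i s => fhat (t k + s) (y k s) i) _
        (fun i => (hF i).1 k _ measurableSet_Ioc (hpos k hk)) _ (hw k)
    have hFi : ∀ k ≥ k0, Integrable (fun s => fhat (t k + s) (y k s) (w k s))
        (volume.restrict (Ioc a b)) := fun k hk => by
      refine Integrable.mono' (integrable_const Ch) (hFm k hk) ?_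
      filter_upwards [ae_restrict_of_ae hCh', ae_restrict_mem measurableSet_Ioc] with s h1 h2
      exact h1 k (hpos k hk s h2) _
    have hfi : ∀ k ≥ k0, Integrable (fun s => f (t k + s) (y k s) (w k s))
        (volume.restrict (Ioc a b)) ∧ y k b - y k a = ∫ s in Ioc a b, f (t k + s) (y k s) (w k s) :=
      fun k hk => by
      have h1 := hk0 k hk
      have ha : -(k:ℝ) ≤ a := by
        have := neg_abs_le a; have := le_max_left |a| |b|; linarith
      have hb : b ≤ (k:ℝ) := (le_abs_self b).trans ((le_max_right _ _).trans h1)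
      obtain ⟨h2, h3⟩ := hint k a b ha hab hb
      rw [intervalIntegral.integral_of_le hab] at h3
      exact ⟨(intervalIntegrable_iff_integrableOn_Ioc_of_le hab).1 h2, h3⟩
    have hΔeq : ∀ k s, Δf (t k + s) (y k s) (w k s) =
        f (t k + s) (y k s) (w k s) - fhat (t k + s) (y k s) (w k s) := fun k s => by
      rw [hdecomp]; abel
    have hD0 : Tendsto (fun k => ∫ s in Ioc a b, Δf (t k + s) (y k s) (w k s)) atTop (𝓝 0) := by
      have := tendsto_integral_filter_of_dominated_convergence (l := atTop)
        (F := fun k s => Δf (t k + s) (y k s) (w k s)) (f := fun _ => (0:E n))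
        (μ := volume.restrict (Ioc a b)) (fun _ => Cf + Ch) ?_ ?_ (integrable_const _) ?_
      · simpa using this
      · filter_upwards [eventually_ge_atTop k0] with k hk
        simp only [hΔeq]
        exact (hfi k hk).1.1.sub (hFm k hk)
      · filter_upwards [eventually_ge_atTop k0] with k hk
        filter_upwards [ae_restrict_of_ae hCh', ae_restrict_of_ae hCf',
          ae_restrict_mem measurableSet_Ioc] with s h1 h2 h3
        rw [hΔeq]
        exact (norm_sub_le _ _).trans (add_le_add (h2 k (hpos k hk s h3) _)
          (h1 k (hpos k hk s h3) _))
      · exact ae_restrict_of_ae hΔ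
    have hsplit : ∀ k ≥ k0, y k b - y k a = (∫ s in Ioc a b, Δf (t k + s) (y k s) (w k s)) +
        ∫ s in Ioc a b, fhat (t k + s) (y k s) (w k s) := fun k hk => by
      rw [(hfi k hk).2]
      simp only [hΔeq]
      rw [integral_sub (hfi k hk).1 (hFi k hk)]
      abel
    rw [intervalIntegral.integral_of_le hab]
    have hGS : Integrable G (volume.restrict (Ioc a b)) :=
      (intervalIntegrable_iff_integrableOn_Ioc_of_le hab).1 (hGi a b hab)
    have hproj : ∀ (j : Fin n) (v : ℝ → E n), Integrable v (volume.restrict (Ioc a b)) →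
        (∫ s in Ioc a b, v s) j = ∫ s in Ioc a b, v s j := fun j v hv =>
      ((EuclideanSpace.proj j : E n →L[ℝ] ℝ).integral_comp_comm hv).symm
    ext j
    have hpc : Continuous fun v : E n => v j :=
      (EuclideanSpace.proj j : E n →L[ℝ] ℝ).continuous
    have hl1 : Tendsto (fun k => (y k b - y k a) j) atTop (𝓝 ((x b - x a) j)) :=
      (hpc.tendsto _).comp ((hx b).sub (hx a))
    have hl2 := (switched_integral_limit w hw u hu hwu (Ioc a b) measurableSet_Ioc M hSM
      (fun k i s => fhat (t k + s) (y k s) i j) (fun i s => fl i s (x s) j) Ch k0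
      (fun k hk i => hpc.comp_aestronglyMeasurable ((hF i).1 k _ measurableSet_Ioc (hpos k hk)))
      (fun k hk i => by
        filter_upwards [ae_restrict_of_ae hCh', ae_restrict_mem measurableSet_Ioc] with s h1 h2
        exact (PiLp.norm_apply_le (fhat (t k + s) (y k s) i) j).trans (h1 k (hpos k hk s h2) i))
      (fun i => by
        filter_upwards [ae_restrict_of_ae (hF i).2] with s hs
        exact (hpc.tendsto _).comp hs)).2.2
    have hl3 := ((hpc.tendsto _).comp hD0).add hl2
    have hz : (0 : E n) j = 0 := rfl
    rw [hz, zero_add] at hl3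
    have hl4 : Tendsto (fun k => (y k b - y k a) j) atTop
        (𝓝 (∫ s in Ioc a b, ∑ i, u s i * fl i s (x s) j)) := by
      refine hl3.congr' ?_
      filter_upwards [eventually_ge_atTop k0] with k hk
      rw [hsplit k hk, PiLp.add_apply, hproj j _ (hFi k hk)]
      rfl
    rw [tendsto_nhds_unique hl1 hl4, hproj j G hGS]
    congr 1; ext s
    simp [hG]
  have hx0 : ∀ s, x s = x 0 + ∫ r in (0:ℝ)..s, G r := by
    intro s
    rcases le_total 0 s with h | h
    · rw [← hkey 0 s h]; abel
    · rw [intervalIntegral.integral_symm, ← hkey s 0 h]; abel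
  have hAC : LocAC x := ⟨G, hGi', hx0⟩
  have hloc : LocallyIntegrable G volume := by
    refine locallyIntegrable_iff.2 fun k hk => ?_
    obtain ⟨M, hM⟩ := hk.isBounded.subset_closedBall 0
    refine (hGiM M).mono_set (hM.trans ?_)
    rw [Real.closedBall_eq_Icc]; simp
  have hder : ∀ᵐ s, HasDerivAt x (G s) s := by
    filter_upwards [LocallyIntegrable.ae_hasDerivAt_integral hloc] with s hs
    have h1 := (hs 0).const_add (x 0)
    exact h1.congr_of_eventuallyEq (Eventually.of_forall hx0)
  have hnn : ∀ᵐ s, ∀ i, 0 ≤ hlm i s (x s) := by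
    filter_upwards [ae_all_iff.2 fun i => (hH i).2] with s hs i
    exact ge_of_tendsto (hs i) (Eventually.of_forall fun k => hη_nonneg _ _ _)
  have hzero : ∀ᵐ s, ∑ i, u s i * hlm i s (x s) = 0 := by
    have hM : ∀ m : ℕ, ∀ᵐ s ∂(volume.restrict (Icc (-(m:ℝ)) m)),
        ∑ i, u s i * hlm i s (x s) = 0 := by
      intro m
      set S := Icc (-(m:ℝ)) m
      have hfin : IsFiniteMeasure (volume.restrict S) := ⟨by simp [S]⟩
      have hpos : ∀ k ≥ m, ∀ s ∈ S, 0 ≤ t k + s := fun k hk =>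
        hposS m k (by exact_mod_cast hk)
      have hl := switched_integral_limit w hw u hu hwu S measurableSet_Icc m le_rfl
        (fun k i s => η i (t k + s) (y k s)) (fun i s => hlm i s (x s)) Ce m
        (fun k hk i => (hH i).1 k _ measurableSet_Icc (hpos k hk))
        (fun k hk i => by
          filter_upwards [ae_restrict_of_ae hCe', ae_restrict_mem measurableSet_Icc] with s h1 h2
          exact h1 k (hpos k hk s h2) i)
        (fun i => ae_restrict_of_ae (hH i).2)
      have hl0 : Tendsto (fun k => ∫ s in S, η (w k s) (t k + s) (y k s)) atTop (𝓝 0) := by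
        have := tendsto_integral_filter_of_dominated_convergence (l := atTop)
          (F := fun k s => η (w k s) (t k + s) (y k s)) (f := fun _ => (0:ℝ))
          (μ := volume.restrict S) (fun _ => Ce) ?_ ?_ (integrable_const _) ?_
        · simpa using this
        · filter_upwards [eventually_ge_atTop m] with k hk
          exact aesm_switched (fun i s => η i (t k + s) (y k s)) _
            (fun i => (hH i).1 k _ measurableSet_Icc (hpos k hk)) _ (hw k)
        · filter_upwards [eventually_ge_atTop m] with k hk
          filter_upwards [ae_restrict_of_ae hCe', ae_restrict_mem measurableSet_Icc] with s h1 h2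
          exact h1 k (hpos k hk s h2) _
        · exact ae_restrict_of_ae h0
      have heq := tendsto_nhds_unique hl.2.2 hl0
      have hi : Integrable (fun s => ∑ i, u s i * hlm i s (x s)) (volume.restrict S) := by
        refine integrable_finsetSum _ fun i _ => ?_
        refine Integrable.bdd_mul (c := 1)
          (Integrable.mono' (integrable_const Ce) (hl.1 i) (hl.2.1 i))
          (hum i).aestronglyMeasurable (ae_of_all _ fun s => ?_)
        rw [Real.norm_of_nonneg ((hu.2 s).1 i), ← (hu.2 s).2]
        exact Finset.single_le_sum (f := u s) (fun j _ => (hu.2 s).1 j) (Finset.mem_univ i)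
      have hn : 0 ≤ᵐ[volume.restrict S] fun s => ∑ i, u s i * hlm i s (x s) := by
        filter_upwards [ae_restrict_of_ae hnn] with s hs
        exact Finset.sum_nonneg fun i _ => mul_nonneg ((hu.2 s).1 i) (hs i)
      exact (integral_eq_zero_iff_of_nonneg_ae hn hi).1 heq
    have h2 : ∀ᵐ s, ∀ m : ℕ, s ∈ Icc (-(m:ℝ)) m → ∑ i, u s i * hlm i s (x s) = 0 :=
      ae_all_iff.2 fun m => (ae_restrict_iff' measurableSet_Icc).1 (hM m)
    filter_upwards [h2] with s hs
    obtain ⟨m, hm⟩ := exists_nat_ge |s|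
    exact hs m (abs_le.1 hm)
  have hfinal := hred t ht fl hlm hfl hhl x u (fun s => hK' (hxK s)) hAC hu (by
    filter_upwards [hder, hzero, hnn] with s h1 h2 h3
    refine ⟨h1, ?_⟩
    rw [← h2]
    exact Finset.sum_congr rfl fun i _ => by rw [Real.norm_of_nonneg (h3 i)]) ⟨K, hK, hK', hxK⟩
  have : δ ≤ ⨅ s, ‖x s‖ := le_ciInf hxδ
  linarith


theorem exists_subseq_ae_zero (p : ℕ → ℝ → ℝ) (hp : ∀ k s, 0 ≤ p k s) (e : ℕ → ℝ)
    (he : Tendsto e atTop (𝓝 0))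
    (hi : ∀ k : ℕ, IntegrableOn (p k) (Ioc (-(k:ℝ)) k) volume)
    (hb : ∀ k : ℕ, ∫ s in Ioc (-(k:ℝ)) k, p k s ≤ e k) :
    ∃ φ : ℕ → ℕ, StrictMono φ ∧ ∀ᵐ s, Tendsto (fun k => p (φ k) s) atTop (𝓝 0) := by
  set F : ℕ → ℝ → ℝ := fun k => (Ioc (-(k:ℝ)) k).indicator (p k) with hF
  have hFi : ∀ k, Integrable (F k) volume := fun k => (hi k).integrable_indicator measurableSet_Ioc
  have hFn : ∀ k s, 0 ≤ F k s := fun k s => indicator_nonneg (fun s _ => hp k s) s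
  have hFe : ∀ k, ∫ s, ‖F k s‖ ≤ e k := fun k => by
    simp only [Real.norm_of_nonneg (hFn k _)]
    rw [integral_indicator measurableSet_Ioc]
    exact hb k
  have hm : TendstoInMeasure volume F atTop (fun _ => (0:ℝ)) := by
    refine tendstoInMeasure_of_tendsto_eLpNorm (p := 1) one_ne_zero (fun k => (hFi k).1)
      aestronglyMeasurable_const ?_
    have h1 : Tendsto (fun k => ENNReal.ofReal (e k)) atTop (𝓝 0) := by
      have := ENNReal.tendsto_ofReal he
      simpa using this
    refine tendsto_of_tendsto_of_tendsto_of_le_of_le tendsto_const_nhds h1 (fun _ => zero_le)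
      fun k => ?_
    have h2 : F k - (fun _ => (0:ℝ)) = F k := by ext s; simp
    simp only [h2]
    rw [eLpNorm_one_eq_lintegral_enorm, ← ofReal_integral_norm_eq_lintegral_enorm (hFi k)]
    exact ENNReal.ofReal_le_ofReal (hFe k)
  obtain ⟨φ, hφ, hl⟩ := hm.exists_seq_tendsto_ae
  refine ⟨φ, hφ, ?_⟩
  filter_upwards [hl] with s hs
  refine hs.congr' ?_
  obtain ⟨m, hm⟩ := exists_nat_gt |s|
  filter_upwards [eventually_ge_atTop m] with k hk
  have h3 : m ≤ φ k := hk.trans (hφ.id_le k)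
  have h4 : |s| < (φ k : ℝ) := hm.trans_le (by exact_mod_cast h3)
  simp only [hF]
  rw [indicator_of_mem]
  exact ⟨(abs_lt.1 h4).1, (abs_lt.1 h4).2.le⟩

theorem core1 {n N : ℕ} {𝒳 : Set (E n)}
    (f fhat Δf : ℝ → E n → Fin N → E n)
    (hdecomp : ∀ t ξ i, f t ξ i = fhat t ξ i + Δf t ξ i)
    (hf_bdd : ∀ i, UnifBounded 𝒳 fun t ξ => f t ξ i)
    (η : Fin N → ℝ → E n → ℝ) (hη_nonneg : ∀ i t ξ, 0 ≤ η i t ξ)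
    (hη_meas : ∀ i ξ, Measurable fun t => η i t ξ)
    (hη_bdd : ∀ i, UnifBounded 𝒳 (η i))
    (hη_contu : ∀ i, ContXiUnifT 𝒳 (η i))
    (hη_pre : ∀ i, Precompact 𝒳 (η i))
    (hfhat_bdd : ∀ i, UnifBounded 𝒳 fun t ξ => fhat t ξ i)
    (hfhat_meas : ∀ i, ∀ ξ ∈ 𝒳, Measurable fun t => fhat t ξ i)
    (hfhat_cont : ∀ i, ContXiUnifT 𝒳 fun t ξ => fhat t ξ i)
    (hfhat_pre : ∀ i, Precompact 𝒳 fun t ξ => fhat t ξ i)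
    (hzp : ∀ i, ZeroingPair 𝒳 (η i) fun t ξ => Δf t ξ i)
    (hred : ∀ γ : ℕ → ℝ, Tendsto γ atTop atTop →
      ∀ (fl : Fin N → ℝ → E n → E n) (hlm : Fin N → ℝ → E n → ℝ),
        (∀ i, IsLimitAlong 𝒳 (fun t ξ => fhat t ξ i) γ (fl i)) →
        (∀ i, IsLimitAlong 𝒳 (η i) γ (hlm i)) →
        ∀ (x : ℝ → E n) (u : ℝ → Fin N → ℝ),
          (∀ t, x t ∈ 𝒳) → LocAC x → IsControl u →
          (∀ᵐ t : ℝ, HasDerivAt x (∑ i, u t i • fl i t (x t)) t ∧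
            ∑ i, u t i * ‖hlm i t (x t)‖ = 0) →
          BoundedRange 𝒳 x →
          (⨅ t : ℝ, ‖x t‖) = 0)
    (K : Set (E n)) (hK : IsCompact K) (hK' : K ⊆ 𝒳) (δ : ℝ) (hδ : 0 < δ)
    (t : ℕ → ℝ) (htk : ∀ k : ℕ, (k : ℝ) ≤ t k)
    (y : ℕ → ℝ → E n) (L : NNReal) (hL : ∀ k, LipschitzWith L (y k))
    (hyK : ∀ k s, y k s ∈ K) (hyδ : ∀ k s, δ ≤ ‖y k s‖)
    (w : ℕ → ℝ → Fin N) (hw : ∀ k, Measurable (w k))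
    (hint : ∀ (k : ℕ) (a b : ℝ), -(k:ℝ) ≤ a → a ≤ b → b ≤ k →
      IntervalIntegrable (fun s => f (t k + s) (y k s) (w k s)) volume a b ∧
      y k b - y k a = ∫ s in a..b, f (t k + s) (y k s) (w k s))
    (e : ℕ → ℝ) (he : Tendsto e atTop (𝓝 0))
    (hi : ∀ k : ℕ, IntegrableOn (fun s => η (w k s) (t k + s) (y k s)) (Ioc (-(k:ℝ)) k) volume)
    (hb : ∀ k : ℕ, ∫ s in Ioc (-(k:ℝ)) k, η (w k s) (t k + s) (y k s) ≤ e k) : False := by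
  have ht : Tendsto t atTop atTop := tendsto_atTop_mono htk tendsto_natCast_atTop_atTop
  obtain ⟨a, ha, h0⟩ := exists_subseq_ae_zero _ (fun k s => hη_nonneg _ _ _) e he hi hb
  have hlimsub : ∀ {F : Type} [TopologicalSpace F] (g : ℝ → E n → F) (γ : ℕ → ℝ) (gl : ℝ → E n → F)
      (ψ : ℕ → ℕ), StrictMono ψ → IsLimitAlong 𝒳 g γ gl → IsLimitAlong 𝒳 g (γ ∘ ψ) gl := by
    rintro F _ g γ gl ψ hψ ⟨Z, hZ, hl⟩
    exact ⟨Z, hZ, fun ξ hξ s hs => (hl ξ hξ s hs).comp hψ.tendsto_atTop⟩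
  obtain ⟨b, hb1, hb2⟩ := exists_subseq_all (ι := Fin N)
    (fun i φ => ∃ gl, IsLimitAlong 𝒳 (fun t ξ => fhat t ξ i) (t ∘ a ∘ φ) gl)
    (by
      rintro i φ ψ ⟨gl, h⟩ hψ
      exact ⟨gl, hlimsub _ _ _ ψ hψ h⟩)
    (by
      intro i φ hφ
      obtain ⟨ψ, h1, h2, gl, h3⟩ := hfhat_pre i (t ∘ a ∘ φ) (ht.comp (ha.comp hφ).tendsto_atTop)
      exact ⟨ψ, h1, gl, h3⟩)
  choose fl hfl using hb2
  obtain ⟨c, hc1, hc2⟩ := exists_subseq_all (ι := Fin N)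
    (fun i φ => ∃ gl, IsLimitAlong 𝒳 (η i) (t ∘ a ∘ b ∘ φ) gl)
    (by
      rintro i φ ψ ⟨gl, h⟩ hψ
      exact ⟨gl, hlimsub _ _ _ ψ hψ h⟩)
    (by
      intro i φ hφ
      obtain ⟨ψ, h1, h2, gl, h3⟩ := hη_pre i (t ∘ a ∘ b ∘ φ)
        (ht.comp (ha.comp (hb1.comp hφ)).tendsto_atTop)
      exact ⟨ψ, h1, gl, h3⟩)
  choose hlm hhl using hc2
  obtain ⟨d, x, hd, hx⟩ := exists_subseq_lipschitz K hK L (fun k => y (a (b (c k))))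
    (fun k s => hyK _ s) (fun k => hL _)
  obtain ⟨g, u, hg, hu, hwu⟩ := exists_control_limit (fun k => w (a (b (c (d k))))) (fun k => hw _)
  set Φ : ℕ → ℕ := fun k => a (b (c (d (g k)))) with hΦ
  have hΦm : StrictMono Φ := ha.comp (hb1.comp (hc1.comp (hd.comp hg)))
  have hkΦ : ∀ k : ℕ, (k:ℝ) ≤ (Φ k : ℝ) := fun k => by exact_mod_cast hΦm.id_le k
  refine core0 f fhat Δf hdecomp hf_bdd η hη_nonneg hη_meas hη_bdd hη_contu hfhat_bdd hfhat_meas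
    hfhat_cont hzp hred K hK hK' δ hδ (fun k => t (Φ k)) (fun k => (hkΦ k).trans (htk _))
    (fun k => y (Φ k)) L (fun k => hL _) (fun k => hyK _) (fun k => hyδ _) (fun k => w (Φ k))
    (fun k => hw _) (fun k p q h1 h2 h3 => hint (Φ k) p q ?_ h2 (h3.trans (hkΦ k))) ?_ x
    (fun s => (hx s).comp hg.tendsto_atTop) fl hlm (fun i => ?_) (fun i => ?_) u hu hwu
  · exact (neg_le_neg (hkΦ k)).trans h1
  · filter_upwards [h0] with s hs
    exact hs.comp (hb1.comp (hc1.comp (hd.comp hg))).tendsto_atTop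
  · exact hlimsub _ _ _ (c ∘ d ∘ g) (hc1.comp (hd.comp hg)) (hfl i)
  · exact hlimsub _ _ _ (d ∘ g) (hd.comp hg) (hhl i)


theorem classK_le {φ : ℝ → ℝ} (h : ClassK φ) {a b : ℝ} (ha : 0 ≤ a) (hb : 0 ≤ b)
    (hab : φ a ≤ φ b) : a ≤ b := (h.2.1.le_iff_le ha hb).1 hab

theorem classK_mono {φ : ℝ → ℝ} (h : ClassK φ) {a b : ℝ} (ha : 0 ≤ a)
    (hab : a ≤ b) : φ a ≤ φ b := (h.2.1.le_iff_le ha (ha.trans hab)).2 hab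

theorem classK_pos {φ : ℝ → ℝ} (h : ClassK φ) {a : ℝ} (ha : 0 < a) : 0 < φ a := by
  have := h.2.1 (mem_Ici.2 le_rfl) (mem_Ici.2 ha.le) ha
  rwa [h.2.2] at this

theorem classK_small {φ : ℝ → ℝ} (h : ClassK φ) {c : ℝ} (hc : 0 < c) :
    ∃ δ, 0 < δ ∧ φ δ ≤ c := by
  have h1 : Tendsto (fun k : ℕ => φ (1 / ((k:ℝ) + 1))) atTop (𝓝 0) :=
    classK_tendsto h (fun k => by positivity) tendsto_one_div_add_atTop_nhds_zero_nat
  obtain ⟨k, hk⟩ := (h1.eventually_le_const hc).exists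
  exact ⟨1 / ((k:ℝ) + 1), by positivity, hk⟩

section Attr

variable {n N : ℕ} {𝒳 : Set (E n)} {f : ℝ → E n → Fin N → E n}

theorem sol_stab (Vb : ℝ → E n → ℝ) (φ₁ φ₂ : ℝ → ℝ)
    (hsandwich : ∀ t : ℝ, 0 ≤ t → ∀ ξ ∈ 𝒳, φ₁ ‖ξ‖ ≤ Vb t ξ ∧ Vb t ξ ≤ φ₂ ‖ξ‖)
    (η : Fin N → ℝ → E n → ℝ) (hη_nonneg : ∀ i t ξ, 0 ≤ η i t ξ)
    (hlyap : ∀ (T : Sol 𝒳 f) (a b : ℝ), T.t0 ≤ a → a ≤ b → (b : EReal) < T.tf →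
      IntervalIntegrable (fun t => η (T.σ t) t (T.x t)) volume a b ∧
      Vb b (T.x b) + ∫ t in a..b, η (T.σ t) t (T.x t) ≤ Vb a (T.x a))
    (T : Sol 𝒳 f) (s t : ℝ) (hs : T.t0 ≤ s) (hst : s ≤ t) (ht : (t : EReal) < T.tf) :
    φ₁ ‖T.x t‖ + ∫ τ in s..t, η (T.σ τ) τ (T.x τ) ≤ φ₂ ‖T.x s‖ ∧
    φ₁ ‖T.x t‖ ≤ φ₂ ‖T.x s‖ ∧ 0 ≤ ∫ τ in s..t, η (T.σ τ) τ (T.x τ) := by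
  have h1 := (hlyap T s t hs hst ht).2
  have h0 := T.t0_nonneg
  have h2 := (hsandwich t (by linarith) _ (T.mem t (hs.trans hst) ht)).1
  have h3 := (hsandwich s (by linarith) _
    (T.mem s hs (lt_of_le_of_lt (by exact_mod_cast hst) ht))).2
  have h4 : 0 ≤ ∫ τ in s..t, η (T.σ τ) τ (T.x τ) :=
    intervalIntegral.integral_nonneg hst fun _ _ => hη_nonneg _ _ _
  exact ⟨by linarith, by linarith, h4⟩

/-- Windows of length `2k` with small dissipation. -/
theorem exists_window (Vb : ℝ → E n → ℝ) (φ₁ φ₂ : ℝ → ℝ) (hφ₁ : ClassK φ₁) (hφ₂ : ClassK φ₂)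
    (hsandwich : ∀ t : ℝ, 0 ≤ t → ∀ ξ ∈ 𝒳, φ₁ ‖ξ‖ ≤ Vb t ξ ∧ Vb t ξ ≤ φ₂ ‖ξ‖)
    (η : Fin N → ℝ → E n → ℝ) (hη_nonneg : ∀ i t ξ, 0 ≤ η i t ξ)
    (hlyap : ∀ (T : Sol 𝒳 f) (a b : ℝ), T.t0 ≤ a → a ≤ b → (b : EReal) < T.tf →
      IntervalIntegrable (fun t => η (T.σ t) t (T.x t)) volume a b ∧
      Vb b (T.x b) + ∫ t in a..b, η (T.σ t) t (T.x t) ≤ Vb a (T.x a))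
    (r R δ ε : ℝ) (hR : 0 ≤ R) (hδ : 0 < δ) (hε : 0 < ε) (hrR : φ₂ r ≤ φ₁ R)
    (hδε : φ₂ δ ≤ φ₁ ε) (k : ℕ)
    (T : Sol 𝒳 f) (s t : ℝ) (hs : T.t0 ≤ s) (hr : ‖T.x s‖ ≤ r)
    (hst : s + 2 * k * (k + 1) ≤ t) (ht : (t : EReal) < T.tf) (hxt : ε < ‖T.x t‖) :
    ∃ c : ℝ, (k:ℝ) ≤ c ∧ T.t0 ≤ c - k ∧ ((c + k : ℝ) : EReal) < T.tf ∧
      (∀ τ ∈ Icc (c - k) (c + k), T.x τ ∈ Metric.closedBall (0 : E n) R ∧ δ ≤ ‖T.x τ‖) ∧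
      ∫ τ in (c - k)..(c + k), η (T.σ τ) τ (T.x τ) ≤ φ₂ r / (k + 1) := by
  have hstab := sol_stab Vb φ₁ φ₂ hsandwich η hη_nonneg hlyap T
  have hkk : (0:ℝ) ≤ 2 * k * (k + 1) := by positivity
  have htf : ∀ τ ≤ t, (τ : EReal) < T.tf := fun τ h => lt_of_le_of_lt (by exact_mod_cast h) ht
  have hin : ∀ τ ∈ Icc s t, T.x τ ∈ Metric.closedBall (0 : E n) R ∧ δ ≤ ‖T.x τ‖ := by
    intro τ hτ
    constructor
    · rw [mem_closedBall_zero_iff]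
      refine classK_le hφ₁ (norm_nonneg _) hR ?_
      exact ((hstab s τ hs hτ.1 (htf τ hτ.2)).2.1.trans
        (classK_mono hφ₂ (norm_nonneg _) hr)).trans hrR
    · by_contra hcon
      push Not at hcon
      have h1 := (hstab τ t (hs.trans hτ.1) hτ.2 ht).2.1
      have h2 := classK_mono hφ₂ (norm_nonneg _) hcon.le
      have h3 := classK_le hφ₁ (norm_nonneg _) hε.le (h1.trans (h2.trans hδε))
      linarith
  set a : ℕ → ℝ := fun p => s + 2 * k * p with ha
  have ham : ∀ p, a p ≤ a (p + 1) := fun p => by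
    simp only [ha]; push_cast; nlinarith [(Nat.cast_nonneg k : (0:ℝ) ≤ k)]
  have has : ∀ p, s ≤ a p := fun p => by
    simp only [ha]
    have : (0:ℝ) ≤ 2 * k * p := by positivity
    linarith
  have hat : ∀ p, p ≤ k + 1 → a p ≤ t := fun p hp => by
    simp only [ha]
    have h1 : (p:ℝ) ≤ k + 1 := by exact_mod_cast hp
    have h2 : 2 * (k:ℝ) * p ≤ 2 * k * (k + 1) := mul_le_mul_of_nonneg_left h1 (by positivity)
    linarith
  have hsum := intervalIntegral.sum_integral_adjacent_intervals (μ := volume) (n := k + 1) (a := a)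
    (f := fun τ => η (T.σ τ) τ (T.x τ))
    (fun p hp => (hlyap T _ _ (hs.trans (has p)) (ham p) (htf _ (hat _ hp))).1)
  have ha0 : a 0 = s := by simp [ha]
  have htot : ∑ p ∈ Finset.range (k + 1), ∫ τ in a p..a (p + 1), η (T.σ τ) τ (T.x τ) ≤ φ₂ r := by
    rw [hsum, ha0]
    have h1 := (hstab s (a (k + 1)) hs (has _) (htf _ (hat _ le_rfl))).1
    have h2 := classK_mono hφ₂ (norm_nonneg _) hr
    have h3 : 0 ≤ φ₁ ‖T.x (a (k + 1))‖ := by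
      have := classK_mono hφ₁ le_rfl (norm_nonneg (T.x (a (k + 1))))
      rwa [hφ₁.2.2] at this
    linarith
  obtain ⟨p, hp, hple⟩ := Finset.exists_le_of_sum_le (s := Finset.range (k + 1))
    (f := fun p => ∫ τ in a p..a (p + 1), η (T.σ τ) τ (T.x τ))
    (g := fun _ => φ₂ r / (k + 1)) ⟨0, by simp⟩ (by
      refine htot.trans (le_of_eq ?_)
      rw [Finset.sum_const, Finset.card_range, nsmul_eq_mul]
      push_cast
      field_simp)
  rw [Finset.mem_range] at hp
  have e1 : a p + k - k = a p := by ring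
  have e2 : a p + k + k = a (p + 1) := by simp only [ha]; push_cast; ring
  refine ⟨a p + k, ?_, ?_, ?_, ?_, ?_⟩
  · have := T.t0_nonneg; have := has p; linarith
  · rw [e1]; exact hs.trans (has p)
  · rw [e2]; exact htf _ (hat _ hp)
  · rw [e1, e2]; exact fun τ hτ => hin τ ⟨(has p).trans hτ.1, hτ.2.trans (hat _ hp)⟩
  · rw [e1, e2]; exact hple

theorem attract (Vb : ℝ → E n → ℝ) (φ₁ φ₂ : ℝ → ℝ) (hφ₁ : ClassK φ₁) (hφ₂ : ClassK φ₂)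
    (hsandwich : ∀ t : ℝ, 0 ≤ t → ∀ ξ ∈ 𝒳, φ₁ ‖ξ‖ ≤ Vb t ξ ∧ Vb t ξ ≤ φ₂ ‖ξ‖)
    (η : Fin N → ℝ → E n → ℝ) (hη_nonneg : ∀ i t ξ, 0 ≤ η i t ξ)
    (hlyap : ∀ (T : Sol 𝒳 f) (a b : ℝ), T.t0 ≤ a → a ≤ b → (b : EReal) < T.tf →
      IntervalIntegrable (fun t => η (T.σ t) t (T.x t)) volume a b ∧
      Vb b (T.x b) + ∫ t in a..b, η (T.σ t) t (T.x t) ≤ Vb a (T.x a))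
    (hf_bdd : ∀ i, UnifBounded 𝒳 fun t ξ => f t ξ i)
    (hcore : ∀ (K : Set (E n)) (hK : IsCompact K) (hK' : K ⊆ 𝒳) (δ : ℝ) (hδ : 0 < δ)
      (t : ℕ → ℝ) (htk : ∀ k : ℕ, (k : ℝ) ≤ t k)
      (y : ℕ → ℝ → E n) (L : NNReal) (hL : ∀ k, LipschitzWith L (y k))
      (hyK : ∀ k s, y k s ∈ K) (hyδ : ∀ k s, δ ≤ ‖y k s‖)
      (w : ℕ → ℝ → Fin N) (hw : ∀ k, Measurable (w k))
      (hint : ∀ (k : ℕ) (a b : ℝ), -(k:ℝ) ≤ a → a ≤ b → b ≤ k →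
        IntervalIntegrable (fun s => f (t k + s) (y k s) (w k s)) volume a b ∧
        y k b - y k a = ∫ s in a..b, f (t k + s) (y k s) (w k s))
      (e : ℕ → ℝ) (he : Tendsto e atTop (𝓝 0))
      (hi : ∀ k : ℕ, IntegrableOn (fun s => η (w k s) (t k + s) (y k s)) (Ioc (-(k:ℝ)) k) volume)
      (hb : ∀ k : ℕ, ∫ s in Ioc (-(k:ℝ)) k, η (w k s) (t k + s) (y k s) ≤ e k), False)
    (r R : ℝ) (hR : 0 ≤ R) (hrR : φ₂ r ≤ φ₁ R) (hRX : Metric.closedBall (0 : E n) R ⊆ 𝒳)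
    (ε : ℝ) (hε : 0 < ε) :
    ∃ Tm : ℝ, ∀ (T : Sol 𝒳 f) (s t : ℝ), T.t0 ≤ s → ‖T.x s‖ ≤ r → s + Tm ≤ t →
      (t : EReal) < T.tf → ‖T.x t‖ ≤ ε := by
  by_contra hcon
  push Not at hcon
  obtain ⟨δ, hδ, hδε⟩ := classK_small hφ₂ (classK_pos hφ₁ hε)
  have hW : ∀ k : ℕ, ∃ (T : Sol 𝒳 f) (c : ℝ), (k:ℝ) ≤ c ∧ T.t0 ≤ c - k ∧
      ((c + k : ℝ) : EReal) < T.tf ∧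
      (∀ τ ∈ Icc (c - k) (c + k), T.x τ ∈ Metric.closedBall (0 : E n) R ∧ δ ≤ ‖T.x τ‖) ∧
      ∫ τ in (c - k)..(c + k), η (T.σ τ) τ (T.x τ) ≤ φ₂ r / (k + 1) := by
    intro k
    obtain ⟨T, s, t, h1, h2, h3, h4, h5⟩ := hcon (2 * k * (k + 1))
    exact ⟨T, exists_window Vb φ₁ φ₂ hφ₁ hφ₂ hsandwich η hη_nonneg hlyap r R δ ε hR hδ hε hrR hδε
      k T s t h1 h2 h3 h4 h5⟩
  choose T c hc1 hc2 hc3 hc4 hc5 using hW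
  set K := Metric.closedBall (0 : E n) R
  have hK : IsCompact K := isCompact_closedBall _ _
  obtain ⟨C, hC0, hC⟩ := unifBounded_all (fun i t ξ => f t ξ i) hf_bdd K hK hRX
  have hkk : ∀ k : ℕ, -(k:ℝ) ≤ k := fun k => by
    have : (0:ℝ) ≤ k := Nat.cast_nonneg k
    linarith
  set y : ℕ → ℝ → E n := fun k s => (T k).x (c k + (projIcc (-(k:ℝ)) k (hkk k) s : ℝ)) with hy
  have hyeq : ∀ (k : ℕ), ∀ s ∈ Icc (-(k:ℝ)) k, y k s = (T k).x (c k + s) := fun k s hs => by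
    simp only [hy, projIcc_of_mem (hkk k) hs]
  have hmem : ∀ (k : ℕ) (s : ℝ), c k + (projIcc (-(k:ℝ)) k (hkk k) s : ℝ) ∈
      Icc (c k - k) (c k + k) := fun k s => by
    have := (projIcc (-(k:ℝ)) k (hkk k) s).2
    exact ⟨by linarith [this.1], by linarith [this.2]⟩
  have htf : ∀ (k : ℕ), ∀ τ ≤ c k + k, (τ : EReal) < (T k).tf := fun k τ h =>
    lt_of_le_of_lt (by exact_mod_cast h) (hc3 k)
  have hlip : ∀ k, LipschitzWith ⟨C, hC0⟩ (y k) := by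
    intro k
    have h1 : LipschitzOnWith ⟨C, hC0⟩ (T k).x (Icc (c k - k) (c k + k)) := by
      refine LipschitzOnWith.of_dist_le_mul ?_
      have key : ∀ s ∈ Icc (c k - k) (c k + k), ∀ t ∈ Icc (c k - k) (c k + k), s ≤ t →
          dist ((T k).x s) ((T k).x t) ≤ C * dist s t := by
        intro s hs t ht hst
        rw [dist_comm, dist_eq_norm, dist_comm s, Real.dist_eq, abs_of_nonneg (sub_nonneg.2 hst)]
        exact sol_bound (T k) K C hC ((hc2 k).trans hs.1) hst (htf k t ht.2)
          fun q hq => (hc4 k q ⟨hs.1.trans hq.1, hq.2.trans ht.2⟩).1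
      intro s hs t ht
      rcases le_total s t with h | h
      · exact key s hs t ht h
      · rw [dist_comm, dist_comm s]; exact key t ht s hs h
    refine LipschitzWith.of_dist_le_mul fun s t => ?_
    refine (h1.dist_le_mul _ (hmem k s) _ (hmem k t)).trans ?_
    refine mul_le_mul_of_nonneg_left ?_ hC0
    rw [dist_add_left]
    have := (LipschitzWith.projIcc (hkk k)).dist_le_mul s t
    simpa [Subtype.dist_eq] using this
  refine hcore K hK hRX δ hδ c hc1 y ⟨C, hC0⟩ hlip (fun k s => (hc4 k _ (hmem k s)).1)
    (fun k s => (hc4 k _ (hmem k s)).2) (fun k s => (T k).σ (c k + s))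
    (fun k => (switching_measurable (T k).switching).comp (measurable_const_add (c k)))
    ?_ (fun k => φ₂ r / (k + 1)) ?_ ?_ ?_
  · intro k a b hka hab hkb
    have hEq : EqOn (fun s => f (c k + s) ((T k).x (c k + s)) ((T k).σ (c k + s)))
        (fun s => f (c k + s) (y k s) ((T k).σ (c k + s))) (Icc a b) := fun s hs => by
      simp only [hyeq k s ⟨hka.trans hs.1, hs.2.trans hkb⟩]
    have hA : (T k).t0 ≤ c k + a := (hc2 k).trans (by linarith)
    have hB := htf k (c k + b) (by linarith)
    have h1 := (T k).intg (c k + a) (c k + b) hA (by linarith) hB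
    have h2 := (T k).sol (c k + a) (c k + b) hA (by linarith) hB
    constructor
    · have h3 := h1.comp_add_left (c k)
      simp only [add_sub_cancel_left] at h3
      refine h3.congr ?_
      rw [uIoc_of_le hab]
      exact fun s hs => hEq (Ioc_subset_Icc_self hs)
    · rw [← intervalIntegral.integral_congr (by rwa [uIcc_of_le hab]),
        hyeq k b ⟨by linarith, hkb⟩, hyeq k a ⟨hka, by linarith⟩, h2, add_sub_cancel_left]
      exact (intervalIntegral.integral_comp_add_left
        (fun τ => f τ ((T k).x τ) ((T k).σ τ)) (c k)).symm
  · have := (tendsto_one_div_add_atTop_nhds_zero_nat (𝕜 := ℝ)).const_mul (φ₂ r)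
    simpa [div_eq_mul_inv] using this
  all_goals
    intro k
    have hEq : EqOn (fun s => η ((T k).σ (c k + s)) (c k + s) ((T k).x (c k + s)))
        (fun s => η ((T k).σ (c k + s)) (c k + s) (y k s)) (Ioc (-(k:ℝ)) k) := fun s hs => by
      simp only [hyeq k s (Ioc_subset_Icc_self hs)]
  · have h1 := (hlyap (T k) (c k - k) (c k + k) (hc2 k) (by linarith [hkk k]) (hc3 k)).1
    have h3 := h1.comp_add_left (c k)
    rw [show c k - k - c k = -(k:ℝ) by ring, show c k + k - c k = (k:ℝ) by ring,
      intervalIntegrable_iff_integrableOn_Ioc_of_le (hkk k)] at h3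
    exact h3.congr_fun hEq measurableSet_Ioc
  · rw [← setIntegral_congr_fun measurableSet_Ioc hEq, ← intervalIntegral.integral_of_le (hkk k)]
    refine le_trans (le_of_eq ?_) (hc5 k)
    have := intervalIntegral.integral_comp_add_left (a := -(k:ℝ)) (b := k)
      (fun τ => η ((T k).σ τ) τ ((T k).x τ)) (c k)
    rw [this, ← sub_eq_add_neg]

end Attr

/-- Corollary 1: UAS/GUAS under arbitrary switchings from a common weak Lyapunov
function, provided each reduced limiting control system (with controls ranging over
all of 𝒰) is WZSD. -/
theorem uas_arbitrary_switching_of_common_weak_lyapunov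
    {n N : ℕ} (𝒳 : Set (E n)) (hXopen : IsOpen 𝒳) (hX0 : (0 : E n) ∈ 𝒳)
    (f fhat Δf : ℝ → E n → Fin N → E n)
    (hdecomp : ∀ t ξ i, f t ξ i = fhat t ξ i + Δf t ξ i)
    (hf_car : ∀ i, Caratheodory 𝒳 fun t ξ => f t ξ i)
    -- Assumption 2: each f_i is uniformly bounded
    (hf_bdd : ∀ i, UnifBounded 𝒳 fun t ξ => f t ξ i)
    -- common weak Lyapunov function V̄ (Assumption 6 with V(t,ξ,i) ≡ V̄(t,ξ) and trivial covering)
    (Vb : ℝ → E n → ℝ) (hV_nonneg : ∀ t ξ, 0 ≤ Vb t ξ)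
    (φ₁ φ₂ : ℝ → ℝ) (hφ₁ : ClassK φ₁) (hφ₂ : ClassK φ₂)
    (hsandwich : ∀ t : ℝ, 0 ≤ t → ∀ ξ ∈ 𝒳, φ₁ ‖ξ‖ ≤ Vb t ξ ∧ Vb t ξ ≤ φ₂ ‖ξ‖)
    (hV_smooth : ContDiffOn ℝ 1 (fun q : ℝ × E n => Vb q.1 q.2) (Ici (0:ℝ) ×ˢ 𝒳))
    (η : Fin N → ℝ → E n → ℝ) (hη_nonneg : ∀ i t ξ, 0 ≤ η i t ξ)
    (hη_meas : ∀ i ξ, Measurable fun t => η i t ξ)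
    (hη_cont : ∀ i, ∀ᵐ t ∂(volume.restrict (Ici (0:ℝ))), ContinuousOn (η i t) 𝒳)
    (hV_decrease : ∀ i : Fin N, ∀ t : ℝ, 0 ≤ t → ∀ ξ ∈ 𝒳,
      ∀ D : ℝ × E n →L[ℝ] ℝ,
        HasFDerivWithinAt (fun q : ℝ × E n => Vb q.1 q.2) D (Ici (0:ℝ) ×ˢ 𝒳) (t, ξ) →
        D (1, f t ξ i) ≤ -(η i t ξ))
    -- Assumption 3 for f and the output h(t,ξ,i) = η_i(t,ξ)
    (hη_bdd : ∀ i, UnifBounded 𝒳 (η i))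
    (hη_contu : ∀ i, ContXiUnifT 𝒳 (η i))
    (hη_pre : ∀ i, Precompact 𝒳 (η i))
    (hfhat_bdd : ∀ i, UnifBounded 𝒳 fun t ξ => fhat t ξ i)
    (hfhat_meas : ∀ i, ∀ ξ ∈ 𝒳, Measurable fun t => fhat t ξ i)
    (hfhat_cont : ∀ i, ContXiUnifT 𝒳 fun t ξ => fhat t ξ i)
    (hfhat_pre : ∀ i, Precompact 𝒳 fun t ξ => fhat t ξ i)
    (hzp : ∀ i, ZeroingPair 𝒳 (η i) fun t ξ => Δf t ξ i)
    -- every reduced limiting control system Σ_γ, with u ranging over all of 𝒰, is WZSD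
    (hred : ∀ γ : ℕ → ℝ, Tendsto γ atTop atTop →
      ∀ (fl : Fin N → ℝ → E n → E n) (hlm : Fin N → ℝ → E n → ℝ),
        (∀ i, IsLimitAlong 𝒳 (fun t ξ => fhat t ξ i) γ (fl i)) →
        (∀ i, IsLimitAlong 𝒳 (η i) γ (hlm i)) →
        ∀ (x : ℝ → E n) (u : ℝ → Fin N → ℝ),
          (∀ t, x t ∈ 𝒳) → LocAC x → IsControl u →
          (∀ᵐ t : ℝ, HasDerivAt x (∑ i, u t i • fl i t (x t)) t ∧
            ∑ i, u t i * ‖hlm i t (x t)‖ = 0) →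
          BoundedRange 𝒳 x →
          (⨅ t : ℝ, ‖x t‖) = 0) :
    UAS {T : Sol 𝒳 f | T.IsMaximal} ∧
      (𝒳 = Set.univ → ClassKInf φ₁ → ClassKInf φ₂ →
        GUAS {T : Sol 𝒳 f | T.IsMaximal}) := by
  have hlyap : ∀ (T : Sol 𝒳 f) (a b : ℝ), T.t0 ≤ a → a ≤ b → (b : EReal) < T.tf →
      IntervalIntegrable (fun t => η (T.σ t) t (T.x t)) volume a b ∧
      Vb b (T.x b) + ∫ t in a..b, η (T.σ t) t (T.x t) ≤ Vb a (T.x a) := fun T a b h1 h2 h3 =>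
    sol_lyap hXopen hf_bdd Vb hV_smooth η hη_meas hη_cont hV_decrease hη_bdd T h1 h2 h3
  have hattr := attract Vb φ₁ φ₂ hφ₁ hφ₂ hsandwich η hη_nonneg hlyap hf_bdd
    (core1 f fhat Δf hdecomp hf_bdd η hη_nonneg hη_meas hη_bdd hη_contu hη_pre hfhat_bdd
      hfhat_meas hfhat_cont hfhat_pre hzp hred)
  have hstab := sol_stab Vb φ₁ φ₂ hsandwich η hη_nonneg hlyap
  have hKL : ∀ P : ℝ → Prop, (∀ r, ∃ r' R, 0 ≤ R ∧ φ₂ r' ≤ φ₁ R ∧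
      Metric.closedBall (0 : E n) R ⊆ 𝒳 ∧ ∀ q, P q → q ≤ r → q ≤ r') →
      ∃ β, ClassKL β ∧ ∀ (T : Sol 𝒳 f) (s t : ℝ), T.InDom s → P ‖T.x s‖ → s ≤ t →
        (t : EReal) < T.tf → ‖T.x t‖ ≤ β ‖T.x s‖ (t - s) := by
    intro P hP
    have hex := exists_KL (fun r d y => ∃ (T : Sol 𝒳 f) (s t : ℝ), T.InDom s ∧
        P ‖T.x s‖ ∧ s ≤ t ∧ (t : EReal) < T.tf ∧ r = ‖T.x s‖ ∧ d = t - s ∧ y = ‖T.x t‖) ?_ ?_ ?_ ?_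
    · obtain ⟨β, hβ, hb⟩ := hex
      exact ⟨β, hβ, fun T s t h1 h2 h3 h4 => hb _ _ _ ⟨T, s, t, h1, h2, h3, h4, rfl, rfl, rfl⟩⟩
    · rintro r d y ⟨T, s, t, h1, h2, h3, h4, rfl, rfl, rfl⟩
      exact ⟨norm_nonneg _, sub_nonneg.2 h3, norm_nonneg _⟩
    · intro r
      obtain ⟨r', R, hR, hrR, -, hq⟩ := hP r
      refine ⟨R, ?_⟩
      rintro _ d y ⟨T, s, t, h1, h2, h3, h4, rfl, rfl, rfl⟩ hr
      exact classK_le hφ₁ (norm_nonneg _) hR (((hstab T s t h1.1 h3 h4).2.1.trans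
        (classK_mono hφ₂ (norm_nonneg _) (hq _ h2 hr))).trans hrR)
    · intro ε hε
      obtain ⟨δ, hδ, hδε⟩ := classK_small hφ₂ (classK_pos hφ₁ hε)
      refine ⟨δ, hδ, ?_⟩
      rintro _ d y ⟨T, s, t, h1, h2, h3, h4, rfl, rfl, rfl⟩ hr
      exact classK_le hφ₁ (norm_nonneg _) hε.le (((hstab T s t h1.1 h3 h4).2.1.trans
        (classK_mono hφ₂ (norm_nonneg _) hr)).trans hδε)
    · intro r ε hε
      obtain ⟨r', R, hR, hrR, hX, hq⟩ := hP r
      obtain ⟨Tm, hTm⟩ := hattr r' R hR hrR hX ε hε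
      refine ⟨Tm, ?_⟩
      rintro _ d y ⟨T, s, t, h1, h2, h3, h4, rfl, rfl, rfl⟩ hr hd
      exact hTm T s t h1.1 (hq _ h2 hr) (by linarith) h4
  constructor
  · obtain ⟨ρ, hρ, hρX⟩ := Metric.nhds_basis_closedBall.mem_iff.1 (hXopen.mem_nhds hX0)
    obtain ⟨δ₀, hδ₀, hle⟩ := classK_small hφ₂ (classK_pos hφ₁ hρ)
    obtain ⟨β, hβ, hb⟩ := hKL (fun q => q < δ₀) fun r =>
      ⟨δ₀, ρ, hρ.le, hle, hρX, fun q hq _ => hq.le⟩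
    exact ⟨β, δ₀, hβ, hδ₀, fun T _ s hs hlt t hst ht => hb T s t hs hlt hst ht⟩
  · intro hX hinf _
    obtain ⟨β, hβ, hb⟩ := hKL (fun _ => True) fun r => by
      obtain ⟨R, hR1, hR2⟩ := ((hinf.2.eventually_ge_atTop (φ₂ r)).and
        (eventually_ge_atTop 0)).exists
      exact ⟨r, R, hR2, hR1, by rw [hX]; exact subset_univ _, fun q _ h => h⟩
    exact ⟨hX, β, hβ, fun T _ s hs t hst ht => hb T s t hs trivial hst ht⟩
end
end

section
/- Let a > 0, T₀ > 0 and δ₀ > 0. Consider the switched system ẋ = f(x, σ(t)) on ℝ² with two modes f₁(ξ) = (ξ₂, −ξ₁) and f₂(ξ) = (−ξ₁^{1/3} + aξ₂, −aξ₁), where ξ₁^{1/3} denotes the real (sign-preserving) cube root. Let S_{T₀,δ₀} be the set of switching signals σ such that |{s ∈ [t, t+T₀] : σ(s) = 2}| ≥ δ₀ for all t ≥ 0, and let 𝒯 be the family of all trajectories (x,σ) with σ ∈ S_{T₀,δ₀}. Then 𝒯 is GUAS: there exists β ∈ 𝒦ℒ such that for every (x,σ) ∈ 𝒯 and every s ∈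 [t₀(x), t_f(x)), |x(t)| ≤ β(|x(s)|, t−s) for all s ≤ t < t_f(x). -/
open MeasureTheory Filter Set Topology

noncomputable section

open SwitchedSys Filter Set MeasureTheory

/-- The real (sign-preserving) cube root. -/
def cbrt (v : ℝ) : ℝ := Real.sign v * |v| ^ ((1:ℝ)/3)

theorem cbrt_cube (u : ℝ) : cbrt u ^ 3 = u := by
  unfold cbrt
  have h : ∀ x : ℝ, 0 ≤ x → (x ^ ((1:ℝ)/3)) ^ 3 = x := by
    intro x hx
    rw [← Real.rpow_natCast, ← Real.rpow_mul hx]; norm_num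
  rw [mul_pow, h _ (abs_nonneg u)]
  rcases lt_trichotomy u 0 with h1 | h1 | h1
  · rw [Real.sign_of_neg h1, abs_of_neg h1]; ring
  · simp [h1]
  · rw [Real.sign_of_pos h1, abs_of_pos h1]; ring

theorem cbrt_cont : Continuous cbrt := by
  have hm : StrictMono (fun x : ℝ => x ^ 3) := Odd.strictMono_pow (by decide)
  have hmono : Monotone cbrt := by
    intro x y hxy
    by_contra! hlt
    have := hm hlt
    simp only [cbrt_cube] at this
    linarith
  apply hmono.continuous_of_surjective
  intro y
  refine ⟨y ^ 3, hm.injective ?_⟩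
  simp only [cbrt_cube]

theorem alg_bound (a ε : ℝ) (ha : 0 < a) (hε : 0 < ε) : ∃ m K : ℝ, 0 < m ∧ 0 < K ∧
    ∀ u v y : ℝ, y ^ 3 = u → ε ^ 2 ≤ u ^ 2 + v ^ 2 →
      m - K * u ^ 2 ≤ v * v ∧ m - K * u ^ 2 ≤ (-y + a * v) * v := by
  set θ := a ^ 2 * ε ^ 2 / 2 with hθ
  have hθ0 : 0 < θ := by positivity
  refine ⟨min 1 (a / 4) * ε ^ 2, 1 + a / 2 + 1 / (2 * a * θ ^ 2), by positivity, by positivity, ?_⟩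
  intro u v y hy hV
  have h1 : min 1 (a / 4) * ε ^ 2 ≤ ε ^ 2 := by
    nlinarith [min_le_left 1 (a / 4), sq_nonneg ε]
  have h2 : min 1 (a / 4) * ε ^ 2 ≤ a / 4 * ε ^ 2 := by
    nlinarith [min_le_right 1 (a / 4), sq_nonneg ε]
  have hq : 0 ≤ 1 / (2 * a * θ ^ 2) * u ^ 2 := by positivity
  have hq2 : 0 ≤ a / 2 * u ^ 2 := by positivity
  refine ⟨by nlinarith, ?_⟩
  have h3 : y ^ 2 ≤ θ + 1 / θ ^ 2 * u ^ 2 := by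
    by_cases hc : y ^ 2 ≤ θ
    · have : 0 ≤ 1 / θ ^ 2 * u ^ 2 := by positivity
      linarith
    · push Not at hc
      have : y ^ 2 ≤ 1 / θ ^ 2 * u ^ 2 := by
        rw [one_div, inv_mul_eq_div, le_div_iff₀ (by positivity), ← hy]
        have : θ ^ 2 ≤ (y ^ 2) ^ 2 := by gcongr
        nlinarith [mul_le_mul_of_nonneg_left this (sq_nonneg y)]
      linarith
  have h4 : y * v ≤ a / 2 * v ^ 2 + 1 / (2 * a) * y ^ 2 := by
    have : a / 2 * v ^ 2 + 1 / (2 * a) * y ^ 2 - y * v = 1 / (2 * a) * (a * v - y) ^ 2 := by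
      field_simp; ring
    have h5 : 0 ≤ 1 / (2 * a) * (a * v - y) ^ 2 := by positivity
    linarith
  have h6 : 1 / (2 * a) * y ^ 2 ≤ a / 4 * ε ^ 2 + 1 / (2 * a * θ ^ 2) * u ^ 2 := by
    have : 1 / (2 * a) * y ^ 2 ≤ 1 / (2 * a) * (θ + 1 / θ ^ 2 * u ^ 2) := by gcongr
    have e : 1 / (2 * a) * (θ + 1 / θ ^ 2 * u ^ 2) = a / 4 * ε ^ 2 + 1 / (2 * a * θ ^ 2) * u ^ 2 := by
      rw [mul_add]
      congr 1
      · rw [hθ]; field_simp; ring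
      · field_simp
    linarith
  have h7 : a / 2 * ε ^ 2 ≤ a / 2 * (u ^ 2 + v ^ 2) := by gcongr
  nlinarith [sq_nonneg u]

def ModeAt (a : ℝ) (u v χ : ℝ → ℝ) (s : ℝ) : Prop :=
  (χ s = 0 ∧ HasDerivWithinAt u (v s) (Ioi s) s ∧ HasDerivWithinAt v (-u s) (Ioi s) s) ∨
  (χ s = 1 ∧ ∃ y : ℝ, y ^ 3 = u s ∧ HasDerivWithinAt u (-y + a * v s) (Ioi s) s ∧
    HasDerivWithinAt v (-(a * u s)) (Ioi s) s)

theorem core (a ε R T₀ δ₀ : ℝ) (ha : 0 < a) (hε : 0 < ε) (hR : 0 < R) (hT₀ : 0 < T₀)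
    (hδ₀ : 0 < δ₀) : ∃ c : ℝ, 0 < c ∧ ∀ (u v χ : ℝ → ℝ) (t : ℝ),
      ContinuousOn u (Icc t (t + T₀)) → ContinuousOn v (Icc t (t + T₀)) →
      (∀ s ∈ Ioo t (t + T₀), ModeAt a u v χ s) →
      IntegrableOn χ (Icc t (t + T₀)) → δ₀ ≤ ∫ s in t..(t + T₀), χ s →
      (∀ s ∈ Icc t (t + T₀), ε ^ 2 ≤ u s ^ 2 + v s ^ 2 ∧ u s ^ 2 + v s ^ 2 ≤ R ^ 2) →
      u (t + T₀) ^ 2 + v (t + T₀) ^ 2 ≤ u t ^ 2 + v t ^ 2 - c := by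
  obtain ⟨m, K, hm, hK, hmK⟩ := alg_bound a ε ha hε
  set C := K + 2 * (1 + a) * R with hC
  have hC0 : 0 < C := by positivity
  set κ := min 1 (δ₀ * m / (4 * (4 * R + C * T₀))) with hκ
  have hκ0 : 0 < κ := by positivity
  have hκ1 : κ ≤ 1 := min_le_left _ _
  set η := κ ^ 3 with hη
  have hη0 : 0 < η := by positivity
  have hη1 : η ≤ κ := by
    rw [hη]; calc κ ^ 3 ≤ κ ^ 1 := pow_le_pow_of_le_one hκ0.le hκ1 (by norm_num)
      _ = κ := pow_one κ
  have hsmall : 2 * η / m * (4 * R + C * T₀) ≤ δ₀ / 2 := by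
    have h1 : η ≤ δ₀ * m / (4 * (4 * R + C * T₀)) := hη1.trans (min_le_right _ _)
    rw [le_div_iff₀ (by positivity)] at h1
    rw [div_mul_eq_mul_div, div_le_iff₀ hm]
    linarith
  refine ⟨δ₀ * κ ^ 4, by positivity, ?_⟩
  intro u v χ t hu hv hmode hint hδ hshell
  have hat : ∀ z : ℝ, |Real.arctan z| ≤ 2 := by
    intro z
    rw [abs_le]
    constructor <;> linarith [Real.arctan_lt_pi_div_two z, Real.neg_pi_div_two_lt_arctan z,
      Real.pi_lt_four]
  have habs : ∀ s ∈ Icc t (t + T₀), |u s| ≤ R ∧ |v s| ≤ R := by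
    intro s hs
    obtain ⟨_, h⟩ := hshell s hs
    constructor <;> apply abs_le_of_sq_le_sq _ hR.le <;> nlinarith [sq_nonneg (u s), sq_nonneg (v s)]
  set G : ℝ → ℝ := fun s => -(u s ^ 2 + v s ^ 2) / (2 * κ ^ 4) +
    2 * η / m * (Real.arctan (u s / η) * v s + C * s) with hG
  have hGc : ContinuousOn G (Icc t (t + T₀)) := by
    have : ContinuousOn (fun s => Real.arctan (u s / η)) (Icc t (t + T₀)) :=
      Real.continuous_arctan.comp_continuousOn (hu.div_const _)
    exact (((hu.pow 2).add (hv.pow 2)).neg.div_const _).add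
      (((this.mul hv).add (continuousOn_const.mul continuousOn_id)).const_mul _)
  have hGd : ∀ s u' v', HasDerivWithinAt u u' (Ioi s) s → HasDerivWithinAt v v' (Ioi s) s →
      HasDerivWithinAt G (-(2 * u s * u' + 2 * v s * v') / (2 * κ ^ 4) +
        2 * η / m * (η / (η ^ 2 + u s ^ 2) * (u' * v s) + Real.arctan (u s / η) * v' + C))
        (Ioi s) s := by
    intro s u' v' h1 h2
    have h3 := (((h1.pow 2).add (h2.pow 2)).neg.div_const (2 * κ ^ 4)).add
      (((((h1.div_const η).arctan).mul h2).add ((hasDerivWithinAt_id s (Ioi s)).const_mul C)).const_mul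
        (2 * η / m))
    refine h3.congr_deriv ?_
    have : η / (η ^ 2 + u s ^ 2) = 1 / (1 + (u s / η) ^ 2) / η := by field_simp
    rw [this]
    simp only [Nat.add_one_sub_one, pow_one, Nat.cast_ofNat]
    ring
  have key : ∀ s ∈ Ioo t (t + T₀), ∃ g', HasDerivWithinAt G g' (Ioi s) s ∧ χ s ≤ g' := by
    intro s hs
    have hs' : s ∈ Icc t (t + T₀) := Ioo_subset_Icc_self hs
    obtain ⟨hua, hva⟩ := habs s hs'
    obtain ⟨hVε, hVR⟩ := hshell s hs'
    set P := η / (η ^ 2 + u s ^ 2) with hP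
    have hP0 : 0 < P := by positivity
    have hPu : P * u s ^ 2 ≤ 1 := by
      rw [hP, div_mul_eq_mul_div, div_le_one (by positivity)]
      nlinarith [sq_nonneg (u s), sq_nonneg η]
    have hlow : ∀ w, m - K * u s ^ 2 ≤ w → P * m - K ≤ P * w := by
      intro w hw
      nlinarith [mul_le_mul_of_nonneg_left hw hP0.le]
    have hatu : |Real.arctan (u s / η) * u s| ≤ 2 * R := by
      rw [abs_mul]; exact mul_le_mul (hat _) hua (abs_nonneg _) (by norm_num)
    rw [abs_le] at hatu
    have hc : 0 < 2 * η / m := by positivity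
    rcases hmode s hs with ⟨h0, hu', hv'⟩ | ⟨h1, y, hy, hu', hv'⟩
    · refine ⟨_, hGd s _ _ hu' hv', ?_⟩
      rw [h0]
      have h := hlow _ (hmK (u s) (v s) (cbrt (u s)) (cbrt_cube _) hVε).1
      have e : -(2 * u s * v s + 2 * v s * -u s) / (2 * κ ^ 4) = 0 := by
        rw [show -(2 * u s * v s + 2 * v s * -u s) = 0 by ring, zero_div]
      rw [e, zero_add]
      apply mul_nonneg hc.le
      have : 0 < P * m := by positivity
      nlinarith [mul_pos ha hR]
    · refine ⟨_, hGd s _ _ hu' hv', ?_⟩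
      rw [h1]
      have h := hlow _ (hmK (u s) (v s) y hy hVε).2
      have e : -(2 * u s * (-y + a * v s) + 2 * v s * -(a * u s)) / (2 * κ ^ 4) = y ^ 4 / κ ^ 4 := by
        rw [← hy]; field_simp; ring
      rw [e]
      have h2 : P * m ≤ P * ((-y + a * v s) * v s) + Real.arctan (u s / η) * -(a * u s) + C := by
        have : a * (Real.arctan (u s / η) * u s) ≤ a * (2 * R) :=
          mul_le_mul_of_nonneg_left hatu.2 ha.le
        nlinarith
      have h3 := mul_le_mul_of_nonneg_left h2 hc.le
      have h4 : 2 * η / m * (P * m) = 2 * η ^ 2 / (η ^ 2 + u s ^ 2) := by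
        rw [hP]; field_simp
      rw [h4] at h3
      have h5 : 1 ≤ y ^ 4 / κ ^ 4 + 2 * η ^ 2 / (η ^ 2 + u s ^ 2) := by
        by_cases hyk : κ ≤ |y|
        · have : 1 ≤ y ^ 4 / κ ^ 4 := by
            rw [one_le_div (by positivity), ← (show Even 4 by decide).pow_abs y]
            gcongr
          have : 0 ≤ 2 * η ^ 2 / (η ^ 2 + u s ^ 2) := by positivity
          linarith
        · push Not at hyk
          have : 1 ≤ 2 * η ^ 2 / (η ^ 2 + u s ^ 2) := by
            rw [one_le_div (by positivity)]
            have : u s ^ 2 ≤ η ^ 2 := by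
              rw [← hy, hη, sq_le_sq, abs_pow, abs_pow, abs_of_pos hκ0]
              gcongr
            linarith
          have : 0 ≤ y ^ 4 / κ ^ 4 := by positivity
          linarith
      linarith
  classical
  choose! g' hg1 hg2 using key
  have hle := intervalIntegral.integral_le_sub_of_hasDeriv_right_of_le (by linarith) hGc hg1 hint hg2
  have hfin : G (t + T₀) - G t ≤ (u t ^ 2 + v t ^ 2 - (u (t + T₀) ^ 2 + v (t + T₀) ^ 2)) / (2 * κ ^ 4)
      + δ₀ / 2 := by
    have hb : ∀ s ∈ Icc t (t + T₀), |Real.arctan (u s / η) * v s| ≤ 2 * R := by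
      intro s hs
      rw [abs_mul]; exact mul_le_mul (hat _) (habs s hs).2 (abs_nonneg _) (by norm_num)
    have b1 := abs_le.1 (hb t ⟨le_rfl, by linarith⟩)
    have b2 := abs_le.1 (hb (t + T₀) ⟨by linarith, le_rfl⟩)
    have e : G (t + T₀) - G t = (u t ^ 2 + v t ^ 2 - (u (t + T₀) ^ 2 + v (t + T₀) ^ 2)) / (2 * κ ^ 4)
      + 2 * η / m * (Real.arctan (u (t + T₀) / η) * v (t + T₀) - Real.arctan (u t / η) * v t + C * T₀) := by
      simp only [hG]; ring
    rw [e]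
    have : 2 * η / m * (Real.arctan (u (t + T₀) / η) * v (t + T₀) - Real.arctan (u t / η) * v t + C * T₀)
        ≤ 2 * η / m * (4 * R + C * T₀) := by
      gcongr; linarith
    linarith
  have h9 : δ₀ / 2 ≤ (u t ^ 2 + v t ^ 2 - (u (t + T₀) ^ 2 + v (t + T₀) ^ 2)) / (2 * κ ^ 4) := by linarith
  rw [le_div_iff₀ (by positivity)] at h9
  linarith

theorem kl_of_bound (g : ℝ → ℝ → ℝ) (hmono : ∀ t, Monotone fun r => g r t)
    (h0 : ∀ r t, 0 ≤ g r t) (hle : ∀ r t, 0 ≤ r → g r t ≤ r)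
    (hanti : ∀ r, AntitoneOn (fun t => g r t) (Ici 0))
    (hlim : ∀ r, Tendsto (fun t => g r t) atTop (nhds 0)) :
    ∃ β : ℝ → ℝ → ℝ, ClassKL β ∧ ∀ r t, 0 ≤ r → g r t ≤ β r t := by
  set I : ℝ → ℝ → ℝ := fun r t => ∫ l in (1:ℝ)..2, g (r * l) t with hI
  have hint : ∀ t a b, IntervalIntegrable (fun r => g r t) volume a b :=
    fun t a b => (hmono t).intervalIntegrable
  have hint2 : ∀ r t, 0 ≤ r → IntervalIntegrable (fun l => g (r * l) t) volume 1 2 := by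
    intro r t hr
    apply Monotone.intervalIntegrable
    intro x y hxy
    exact hmono t (mul_le_mul_of_nonneg_left hxy hr)
  have hI1 : ∀ r t, 0 ≤ r → g r t ≤ I r t := by
    intro r t hr
    have := intervalIntegral.integral_mono_on (a := 1) (b := 2) (μ := volume) (f := fun _ => g r t)
      (g := fun l => g (r * l) t) (by norm_num) (by simp) (hint2 r t hr)
      (fun l hl => hmono t (by nlinarith [hl.1] : r ≤ r * l))
    norm_num at this
    exact this
  have hI2 : ∀ r t, 0 ≤ r → I r t ≤ g (2 * r) t := by
    intro r t hr
    have := intervalIntegral.integral_mono_on (a := 1) (b := 2) (μ := volume) (g := fun _ => g (2 * r) t)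
      (f := fun l => g (r * l) t) (by norm_num) (hint2 r t hr) (by simp)
      (fun l hl => hmono t (by nlinarith [hl.2] : r * l ≤ 2 * r))
    norm_num at this
    exact this
  refine ⟨fun r t => I r t + r * Real.exp (-t), ⟨?_, ?_⟩, ?_⟩
  · intro t ht
    refine ⟨⟨?_, ?_, ?_⟩, ?_⟩
    · intro r hr
      have hr : 0 ≤ r := hr
      apply ContinuousWithinAt.add
      · rcases hr.eq_or_lt with h | h
        · subst h
          have e : I 0 t = 0 := le_antisymm ((hI2 0 t le_rfl).trans (by simpa using hle 0 t le_rfl))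
            ((h0 0 t).trans (hI1 0 t le_rfl))
          show Tendsto (fun r => I r t) (𝓝[≥] 0) (𝓝 (I 0 t))
          rw [e]
          have h2 : Tendsto (fun r : ℝ => 2 * r) (𝓝[Ici 0] 0) (𝓝 0) := by
            have : Tendsto (fun r : ℝ => 2 * r) (𝓝 0) (𝓝 (2 * 0)) := tendsto_id.const_mul 2
            rw [mul_zero] at this
            exact this.mono_left nhdsWithin_le_nhds
          refine tendsto_of_tendsto_of_tendsto_of_le_of_le' tendsto_const_nhds h2 ?_ ?_
          · filter_upwards [self_mem_nhdsWithin] with r hr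
            exact (h0 r t).trans (hI1 r t hr)
          · filter_upwards [self_mem_nhdsWithin] with r hr
            have hr : 0 ≤ r := hr
            exact (hI2 r t hr).trans (hle _ t (by positivity))
        · have hc : Continuous fun b => ∫ x in (0:ℝ)..b, g x t :=
            intervalIntegral.continuous_primitive (hint t) 0
          have hc2 : ContinuousAt (fun r => r⁻¹ * ((∫ x in (0:ℝ)..(r * 2), g x t) -
              ∫ x in (0:ℝ)..r, g x t)) r := by
            apply ContinuousAt.mul (continuousAt_inv₀ h.ne')
            exact ((hc.comp (continuous_id.mul continuous_const)).sub hc).continuousAt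
          refine (hc2.congr ?_).continuousWithinAt
          filter_upwards [lt_mem_nhds h] with r' hr'
          have := intervalIntegral.integral_comp_mul_left (a := 1) (b := 2) (fun x => g x t) hr'.ne'
          simp only [hI]
          rw [this, intervalIntegral.integral_interval_sub_left (hint _ _ _) (hint _ _ _)]
          simp
      · exact (continuous_id.mul continuous_const).continuousWithinAt
    · intro x hx y hy hxy
      have hx : 0 ≤ x := hx
      have hy : 0 ≤ y := hy
      have : I x t ≤ I y t := by
        apply intervalIntegral.integral_mono_on (by norm_num) (hint2 x t hx) (hint2 y t hy)
        intro l hl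
        exact hmono t (by nlinarith [hl.1])
      have : x * Real.exp (-t) < y * Real.exp (-t) := by gcongr
      show _ + _ < _ + _
      linarith
    · have e : I 0 t = 0 := le_antisymm ((hI2 0 t le_rfl).trans (by simpa using hle 0 t le_rfl))
            ((h0 0 t).trans (hI1 0 t le_rfl))
      simp [e]
    · have : Tendsto (fun r : ℝ => r * Real.exp (-t)) atTop atTop :=
        tendsto_id.atTop_mul_const (Real.exp_pos _)
      refine tendsto_atTop_mono' _ ?_ this
      filter_upwards [eventually_ge_atTop 0] with r hr
      have := (h0 r t).trans (hI1 r t hr)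
      linarith
  · intro r hr
    constructor
    · intro t ht t' ht' htt
      have : I r t' ≤ I r t := by
        apply intervalIntegral.integral_mono_on (by norm_num) (hint2 r _ hr) (hint2 r _ hr)
        intro l hl
        exact hanti _ ht ht' htt
      have : r * Real.exp (-t') ≤ r * Real.exp (-t) := by gcongr
      show _ + _ ≤ _ + _
      linarith
    · have h1 : Tendsto (fun t => I r t) atTop (nhds 0) :=
        tendsto_of_tendsto_of_tendsto_of_le_of_le tendsto_const_nhds (hlim (2 * r))
          (fun t => (h0 r t).trans (hI1 r t hr)) (fun t => hI2 r t hr)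
      have h2 : Tendsto (fun t => r * Real.exp (-t)) atTop (nhds (r * 0)) :=
        (Real.tendsto_exp_neg_atTop_nhds_zero).const_mul r
      simpa using h1.add h2
  · intro r t hr
    have := hI1 r t hr
    have : 0 ≤ r * Real.exp (-t) := by positivity
    show _ ≤ _ + _
    linarith

theorem sigma_right {σ : ℝ → Fin 2} (hσ : IsSwitchingSignal σ) (t : ℝ) :
    ∃ b, t < b ∧ ∀ s ∈ Ico t b, σ s = σ t := by
  obtain ⟨k, τ, h0, hk, hlt, hc⟩ := hσ t (t + 1) (by linarith)
  have hk0 : 0 < k := by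
    rcases Nat.eq_zero_or_pos k with h | h
    · subst h; linarith
    · exact h
  have h1 := hlt 0 hk0
  have h2 := hc 0 hk0
  rw [h0] at h1 h2
  exact ⟨_, h1, h2⟩

def chi (σ : ℝ → Fin 2) (s : ℝ) : ℝ := if σ s = 1 then 1 else 0

theorem chi_meas {σ : ℝ → Fin 2} (hσ : IsSwitchingSignal σ) : Measurable (chi σ) := by
  apply measurable_of_tendsto_metrizable
    (f := fun (n : ℕ) s => chi σ (((⌊((n:ℝ) + 1) * s⌋ : ℤ) + 1 : ℝ) / ((n:ℝ) + 1)))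
  · intro n
    have h1 : Measurable (fun k : ℤ => chi σ (((k : ℝ) + 1) / ((n:ℝ) + 1))) := measurable_from_top
    have h2 : Measurable (fun s : ℝ => ⌊((n:ℝ) + 1) * s⌋) :=
      Int.measurable_floor.comp (measurable_const.mul measurable_id)
    exact h1.comp h2
  · rw [tendsto_pi_nhds]
    intro s
    obtain ⟨b, hb, hs⟩ := sigma_right hσ s
    apply tendsto_const_nhds.congr'
    have hl : Tendsto (fun n : ℕ => 1 / ((n:ℝ) + 1)) atTop (𝓝 0) :=
      tendsto_one_div_add_atTop_nhds_zero_nat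
    filter_upwards [hl.eventually (gt_mem_nhds (sub_pos.2 hb))] with n hn
    have hn0 : (0:ℝ) < (n:ℝ) + 1 := by positivity
    unfold chi
    rw [hs ((((⌊((n:ℝ) + 1) * s⌋ : ℤ) : ℝ) + 1) / ((n:ℝ) + 1))]
    constructor
    · rw [le_div_iff₀ hn0]
      linarith [Int.lt_floor_add_one (((n:ℝ) + 1) * s)]
    · have : ((⌊((n:ℝ) + 1) * s⌋ : ℤ) + 1 : ℝ) / ((n:ℝ) + 1) ≤ s + 1 / ((n:ℝ) + 1) := by
        rw [div_le_iff₀ hn0, add_mul s, one_div, inv_mul_cancel₀ hn0.ne']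
        linarith [Int.floor_le (((n:ℝ) + 1) * s)]
      linarith

section traj

variable {a T₀ δ₀ : ℝ} {f : ℝ → E 2 → Fin 2 → E 2}

theorem x_cont (T : Sol (univ : Set (E 2)) f) (p q : ℝ) (hp : T.t0 ≤ p) (hpq : p ≤ q)
    (hq : (q : EReal) < T.tf) : ContinuousOn T.x (Icc p q) := by
  have h1 := T.intg p q hp hpq hq
  have h2 : ContinuousOn (fun s => T.x p + ∫ τ in p..s, f τ (T.x τ) (T.σ τ)) (uIcc p q) :=
    continuousOn_const.add
      (intervalIntegral.continuousOn_primitive_interval' h1 left_mem_uIcc)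
  rw [uIcc_of_le hpq] at h2
  refine h2.congr ?_
  intro s hs
  exact T.sol p s hp hs.1 (lt_of_le_of_lt (by exact_mod_cast hs.2) hq)

theorem x_deriv (hf : ∀ (t : ℝ) (ξ : E 2),
      f t ξ 0 = (WithLp.equiv 2 (Fin 2 → ℝ)).symm ![ξ 1, -ξ 0] ∧
      f t ξ 1 = (WithLp.equiv 2 (Fin 2 → ℝ)).symm ![-cbrt (ξ 0) + a * ξ 1, -(a * ξ 0)])
    (T : Sol (univ : Set (E 2)) f) (s : ℝ) (hs : T.InDom s) :
    HasDerivWithinAt T.x (f s (T.x s) (T.σ s)) (Ioi s) s := by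
  obtain ⟨q, hsq, hq⟩ := EReal.lt_iff_exists_real_btwn.1 hs.2
  have hsq : s < q := by exact_mod_cast hsq
  obtain ⟨b, hb, hσ⟩ := sigma_right T.switching s
  have hmem : Ioo s (min q b) ∈ 𝓝[>] s := Ioo_mem_nhdsGT (lt_min hsq hb)
  have hfc : ∀ i : Fin 2, Continuous fun ξ => f s ξ i := by
    intro i
    have hw : Continuous (WithLp.equiv 2 (Fin 2 → ℝ)).symm :=
      PiLp.continuous_toLp 2 (fun _ : Fin 2 => ℝ)
    have c0 : Continuous fun ξ : E 2 => ξ 0 := by fun_prop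
    have c1 : Continuous fun ξ : E 2 => ξ 1 := by fun_prop
    fin_cases i
    · have : (fun ξ => f s ξ 0) = fun ξ : E 2 => (WithLp.equiv 2 (Fin 2 → ℝ)).symm ![ξ 1, -ξ 0] := by
        funext ξ; exact (hf s ξ).1
      show Continuous (fun ξ => f s ξ 0)
      rw [this]
      apply hw.comp
      apply continuous_pi
      intro j
      fin_cases j
      · exact c1
      · exact c0.neg
    · have : (fun ξ => f s ξ 1) = fun ξ : E 2 => (WithLp.equiv 2 (Fin 2 → ℝ)).symm
          ![-cbrt (ξ 0) + a * ξ 1, -(a * ξ 0)] := by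
        funext ξ; exact (hf s ξ).2
      show Continuous (fun ξ => f s ξ 1)
      rw [this]
      apply hw.comp
      apply continuous_pi
      intro j
      fin_cases j
      · exact (cbrt_cont.comp c0).neg.add (continuous_const.mul c1)
      · exact (continuous_const.mul c0).neg
  have hft : ∀ t ξ i, f t ξ i = f s ξ i := by
    intro t ξ i
    fin_cases i
    · exact (hf t ξ).1.trans (hf s ξ).1.symm
    · exact (hf t ξ).2.trans (hf s ξ).2.symm
  have hxc := x_cont T s q hs.1 hsq.le hq
  have hxs : ContinuousWithinAt T.x (Ioi s) s :=
    (hxc s ⟨le_rfl, hsq.le⟩).mono_of_mem_nhdsWithin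
      (mem_of_superset (Ioo_mem_nhdsGT hsq) Ioo_subset_Icc_self)
  have hF : ContinuousWithinAt (fun τ => f τ (T.x τ) (T.σ τ)) (Ioi s) s := by
    have h1 : ContinuousWithinAt (fun τ => f s (T.x τ) (T.σ s)) (Ioi s) s :=
      (hfc (T.σ s)).continuousAt.comp_continuousWithinAt hxs
    refine h1.congr_of_eventuallyEq ?_ rfl
    filter_upwards [hmem] with τ hτ
    rw [hσ τ ⟨hτ.1.le, lt_of_lt_of_le hτ.2 (min_le_right _ _)⟩, hft τ]
  have hint := T.intg s q hs.1 hsq.le hq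
  have hmeas : StronglyMeasurableAtFilter (fun τ => f τ (T.x τ) (T.σ τ)) (𝓝[>] s) := by
    refine ⟨Ioc s q, Ioc_mem_nhdsGT hsq, ?_⟩
    exact hint.1.aestronglyMeasurable
  have hd : HasDerivWithinAt (fun u => ∫ τ in s..u, f τ (T.x τ) (T.σ τ))
      (f s (T.x s) (T.σ s)) (Ici s) s :=
    intervalIntegral.integral_hasDerivWithinAt_right (by simp) hmeas hF
  have hd2 := (hd.const_add (T.x s)).mono Ioi_subset_Ici_self
  refine hd2.congr_of_eventuallyEq ?_ (by simp)
  filter_upwards [hmem] with τ hτ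
  exact T.sol s τ hs.1 hτ.1.le
    (lt_trans (by exact_mod_cast lt_of_lt_of_le hτ.2 (min_le_left _ _)) hq)

theorem x_mode (hf : ∀ (t : ℝ) (ξ : E 2),
      f t ξ 0 = (WithLp.equiv 2 (Fin 2 → ℝ)).symm ![ξ 1, -ξ 0] ∧
      f t ξ 1 = (WithLp.equiv 2 (Fin 2 → ℝ)).symm ![-cbrt (ξ 0) + a * ξ 1, -(a * ξ 0)])
    (T : Sol (univ : Set (E 2)) f) (s : ℝ) (hs : T.InDom s) :
    ModeAt a (fun t => T.x t 0) (fun t => T.x t 1) (chi T.σ) s := by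
  have hd := x_deriv hf T s hs
  have hi : ∀ i : Fin 2, HasDerivWithinAt (fun t => T.x t i) (f s (T.x s) (T.σ s) i) (Ioi s) s := by
    intro i
    exact (EuclideanSpace.proj i : E 2 →L[ℝ] ℝ).hasFDerivAt.comp_hasDerivWithinAt s hd
  have h0 := hi 0
  have h1 := hi 1
  unfold ModeAt chi
  by_cases hσ : T.σ s = 1
  · right
    rw [hσ, (hf s (T.x s)).2] at h0 h1
    exact ⟨by simp [hσ], cbrt (T.x s 0), cbrt_cube _, h0, h1⟩
  · left
    have hσ0 : T.σ s = 0 := by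
      revert hσ; generalize T.σ s = j; fin_cases j <;> simp
    rw [hσ0, (hf s (T.x s)).1] at h0 h1
    exact ⟨by simp [hσ], h0, h1⟩

theorem norm_sq_eq (ξ : E 2) : ‖ξ‖ ^ 2 = ξ 0 ^ 2 + ξ 1 ^ 2 := by
  rw [EuclideanSpace.real_norm_sq_eq]; simp

theorem coord_cont (T : Sol (univ : Set (E 2)) f) (p q : ℝ) (hp : T.t0 ≤ p) (hpq : p ≤ q)
    (hq : (q : EReal) < T.tf) (i : Fin 2) : ContinuousOn (fun t => T.x t i) (Icc p q) := by
  have c : Continuous fun ξ : E 2 => ξ i := by fun_prop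
  exact c.comp_continuousOn (x_cont T p q hp hpq hq)

theorem norm_anti (hf : ∀ (t : ℝ) (ξ : E 2),
      f t ξ 0 = (WithLp.equiv 2 (Fin 2 → ℝ)).symm ![ξ 1, -ξ 0] ∧
      f t ξ 1 = (WithLp.equiv 2 (Fin 2 → ℝ)).symm ![-cbrt (ξ 0) + a * ξ 1, -(a * ξ 0)])
    (T : Sol (univ : Set (E 2)) f) (p q : ℝ) (hp : T.t0 ≤ p) (hpq : p ≤ q)
    (hq : (q : EReal) < T.tf) : ‖T.x q‖ ≤ ‖T.x p‖ := by
  have c0 := coord_cont T p q hp hpq hq 0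
  have c1 := coord_cont T p q hp hpq hq 1
  have key : ∀ s ∈ Ioo p q, ∃ g', HasDerivWithinAt (fun t => -(T.x t 0 ^ 2 + T.x t 1 ^ 2)) g' (Ioi s) s
      ∧ (0:ℝ) ≤ g' := by
    intro s hs
    have hD : T.InDom s := ⟨hp.trans hs.1.le, lt_trans (by exact_mod_cast hs.2) hq⟩
    rcases x_mode hf T s hD with ⟨-, hu, hv⟩ | ⟨-, y, hy, hu, hv⟩
    · refine ⟨_, ((hu.pow 2).add (hv.pow 2)).neg, ?_⟩
      simp only [Nat.add_one_sub_one, pow_one, Nat.cast_ofNat]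
      apply le_of_eq; ring
    · refine ⟨_, ((hu.pow 2).add (hv.pow 2)).neg, ?_⟩
      simp only [Nat.add_one_sub_one, pow_one, Nat.cast_ofNat]
      have hy : y ^ 3 = T.x s 0 := hy
      rw [← hy]
      have : 0 ≤ 2 * y ^ 4 := by positivity
      linarith
  choose! g' h1 h2 using key
  have := intervalIntegral.integral_le_sub_of_hasDeriv_right_of_le (φ := fun _ => 0) hpq
    (((c0.pow 2).add (c1.pow 2)).neg) h1 (by simp) h2
  simp only [intervalIntegral.integral_zero, Pi.neg_apply, Pi.add_apply, Pi.pow_apply] at this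
  refine (sq_le_sq₀ (norm_nonneg _) (norm_nonneg _)).1 ?_
  rw [norm_sq_eq, norm_sq_eq]
  linarith

end traj

theorem chi_int {σ : ℝ → Fin 2} (hσ : IsSwitchingSignal σ) (t b : ℝ) :
    IntegrableOn (chi σ) (Icc t b) := by
  apply Measure.integrableOn_of_bounded (M := 1) (by simp) (chi_meas hσ).aestronglyMeasurable
  apply Eventually.of_forall
  intro s
  unfold chi
  split_ifs <;> simp

theorem chi_lower {σ : ℝ → Fin 2} (hσ : IsSwitchingSignal σ) (t T₀ δ₀ : ℝ) (hT₀ : 0 < T₀)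
    (h : ENNReal.ofReal δ₀ ≤ volume {s | s ∈ Icc t (t + T₀) ∧ σ s = 1}) :
    δ₀ ≤ ∫ s in t..(t + T₀), chi σ s := by
  have hms : MeasurableSet {s | σ s = 1} := by
    have : {s | σ s = 1} = chi σ ⁻¹' {1} := by
      ext s; simp [chi]
    rw [this]
    exact chi_meas hσ (measurableSet_singleton 1)
  have he : chi σ = indicator {s | σ s = 1} 1 := by
    funext s; simp [chi, indicator]
  rw [intervalIntegral.integral_of_le (by linarith), ← integral_Icc_eq_integral_Ioc, he,
    integral_indicator_one hms, measureReal_restrict_apply hms]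
  have e2 : {s | s ∈ Icc t (t + T₀) ∧ σ s = 1} = {s | σ s = 1} ∩ Icc t (t + T₀) := by
    ext s; simp [and_comm]
  rw [e2] at h
  apply (ENNReal.ofReal_le_iff_le_toReal _).1 h
  exact ne_top_of_le_ne_top (by simp) (measure_mono (inter_subset_right (s := {s | σ s = 1})
    (t := Icc t (t + T₀))))

theorem attract_s15 {a T₀ δ₀ : ℝ} (ha : 0 < a) (hT₀ : 0 < T₀) (hδ₀ : 0 < δ₀)
    {f : ℝ → E 2 → Fin 2 → E 2} (hf : ∀ (t : ℝ) (ξ : E 2),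
      f t ξ 0 = (WithLp.equiv 2 (Fin 2 → ℝ)).symm ![ξ 1, -ξ 0] ∧
      f t ξ 1 = (WithLp.equiv 2 (Fin 2 → ℝ)).symm ![-cbrt (ξ 0) + a * ξ 1, -(a * ξ 0)])
    (R ε : ℝ) (hR : 0 < R) (hε : 0 < ε) :
    ∃ τ : ℝ, ∀ T : Sol (univ : Set (E 2)) f,
      (∀ t : ℝ, 0 ≤ t →
        ENNReal.ofReal δ₀ ≤ volume {s | s ∈ Icc t (t + T₀) ∧ T.σ s = 1}) →
      ∀ s q : ℝ, T.InDom s → ‖T.x s‖ ≤ R → s ≤ q → s + τ ≤ q → (q : EReal) < T.tf →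
        ‖T.x q‖ ≤ ε := by
  obtain ⟨c, hc, hcore⟩ := core a ε R T₀ δ₀ ha hε hR hT₀ hδ₀
  obtain ⟨N, hN⟩ := exists_nat_gt (R ^ 2 / c)
  rw [div_lt_iff₀ hc] at hN
  refine ⟨N * T₀, ?_⟩
  intro T hdw s q hs hxs hsq hτ hq
  by_contra! hcon
  have hdec : ∀ k : ℕ, k ≤ N → ‖T.x (s + k * T₀)‖ ^ 2 ≤ R ^ 2 - k * c := by
    intro k
    induction k with
    | zero =>
      intro _
      simp only [Nat.cast_zero, zero_mul, add_zero, sub_zero]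
      gcongr
    | succ k ih =>
      intro hk
      have hk1 := ih (by omega)
      have hkN : ((k:ℝ) + 1) * T₀ ≤ N * T₀ := by
        have : ((k:ℝ) + 1) ≤ N := by exact_mod_cast hk
        gcongr
      set t := s + k * T₀ with ht
      have hkT : 0 ≤ (k:ℝ) * T₀ := by positivity
      have hst : s ≤ t := by linarith
      have htq : t + T₀ ≤ q := by rw [ht]; linarith
      have htf : ((t + T₀ : ℝ) : EReal) < T.tf := lt_of_le_of_lt (by exact_mod_cast htq) hq
      have ht0 : T.t0 ≤ t := hs.1.trans hst
      have hle : t ≤ t + T₀ := by linarith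
      have h := hcore (fun t => T.x t 0) (fun t => T.x t 1) (chi T.σ) t
        (coord_cont T _ _ ht0 hle htf 0) (coord_cont T _ _ ht0 hle htf 1)
        (fun w hw => x_mode hf T w ⟨ht0.trans hw.1.le, lt_trans (by exact_mod_cast hw.2) htf⟩)
        (chi_int T.switching _ _)
        (chi_lower T.switching t T₀ δ₀ hT₀ (hdw t (T.t0_nonneg.trans ht0)))
        (by
          intro w hw
          have hwf : (w : EReal) < T.tf := lt_of_le_of_lt (by exact_mod_cast hw.2) htf
          simp only []
          rw [← norm_sq_eq]
          constructor
          · have := norm_anti hf T w q (ht0.trans hw.1) (hw.2.trans htq) hq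
            gcongr
            linarith
          · have := norm_anti hf T s w hs.1 (hst.trans hw.1) hwf
            gcongr
            linarith)
      simp only [] at h
      rw [← norm_sq_eq, ← norm_sq_eq] at h
      have e : s + ((k + 1 : ℕ) : ℝ) * T₀ = t + T₀ := by rw [ht]; push_cast; ring
      rw [e]
      push_cast
      linarith
  have := hdec N le_rfl
  nlinarith [sq_nonneg ‖T.x (s + N * T₀)‖]


/-- The motivating example: the switched system on ℝ² with modes
f₁(ξ) = (ξ₂, −ξ₁), f₂(ξ) = (−ξ₁^{1/3} + aξ₂, −aξ₁), is GUAS over the family of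
trajectories whose switching signals activate mode 2 for at least δ₀ time units on
every window of length T₀. -/
theorem motivating_example_guas (a T₀ δ₀ : ℝ) (ha : 0 < a) (hT₀ : 0 < T₀) (hδ₀ : 0 < δ₀)
    (f : ℝ → E 2 → Fin 2 → E 2)
    (hf : ∀ (t : ℝ) (ξ : E 2),
      f t ξ 0 = (WithLp.equiv 2 (Fin 2 → ℝ)).symm ![ξ 1, -ξ 0] ∧
      f t ξ 1 = (WithLp.equiv 2 (Fin 2 → ℝ)).symm ![-cbrt (ξ 0) + a * ξ 1, -(a * ξ 0)])
    (𝒯 : Set (Sol (univ : Set (E 2)) f))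
    (h𝒯 : 𝒯 = {T : Sol (univ : Set (E 2)) f | T.IsMaximal ∧
      ∀ t : ℝ, 0 ≤ t →
        ENNReal.ofReal δ₀ ≤ volume {s | s ∈ Icc t (t + T₀) ∧ T.σ s = 1}}) :
    GUAS 𝒯 := by
  refine ⟨rfl, ?_⟩
  subst h𝒯
  set 𝒯 : Set (Sol (univ : Set (E 2)) f) := {T : Sol (univ : Set (E 2)) f | T.IsMaximal ∧
      ∀ t : ℝ, 0 ≤ t →
        ENNReal.ofReal δ₀ ≤ volume {s | s ∈ Icc t (t + T₀) ∧ T.σ s = 1}} with h𝒯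
  set S : ℝ → ℝ → Set ℝ := fun r t => {z | z = 0 ∨ ∃ T ∈ 𝒯, ∃ s q : ℝ, T.InDom s ∧ ‖T.x s‖ ≤ r ∧
    s ≤ q ∧ s + t ≤ q ∧ (q : EReal) < T.tf ∧ z = ‖T.x q‖} with hS
  have hSne : ∀ r t, (S r t).Nonempty := fun r t => ⟨0, Or.inl rfl⟩
  have hSub : ∀ r t, ∀ z ∈ S r t, z ≤ max r 0 := by
    rintro r t z (h | ⟨T, hT, s, q, hs, hr, hsq, -, hq, h⟩)
    · rw [h]; exact le_max_right _ _
    · rw [h]; exact ((norm_anti hf T s q hs.1 hsq hq).trans hr).trans (le_max_left _ _)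
  have hSb : ∀ r t, BddAbove (S r t) := fun r t => ⟨max r 0, hSub r t⟩
  have hkl : ∃ β : ℝ → ℝ → ℝ, ClassKL β ∧ ∀ r t, 0 ≤ r → sSup (S r t) ≤ β r t := by
    refine kl_of_bound (fun r t => sSup (S r t)) ?_ ?_ ?_ ?_ ?_
    · intro t r r' hrr
      apply csSup_le_csSup (hSb _ _) (hSne _ _)
      rintro z (h | ⟨T, hT, s, q, hs, hr, h⟩)
      · exact Or.inl h
      · exact Or.inr ⟨T, hT, s, q, hs, hr.trans hrr, h⟩
    · intro r t
      exact le_csSup (hSb r t) (Or.inl rfl)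
    · intro r t hr
      exact (csSup_le (hSne r t) (hSub r t)).trans (max_eq_left hr).le
    · intro r t ht t' ht' htt
      apply csSup_le_csSup (hSb _ _) (hSne _ _)
      rintro z (h | ⟨T, hT, s, q, hs, hr, hsq, hq, h⟩)
      · exact Or.inl h
      · exact Or.inr ⟨T, hT, s, q, hs, hr, hsq, by linarith, h⟩
    · intro r
      rw [Metric.tendsto_atTop]
      intro ε hε
      obtain ⟨τ, hτ⟩ := attract_s15 ha hT₀ hδ₀ hf (max r 1) (ε / 2) (by positivity) (by positivity)
      refine ⟨τ, fun t ht => ?_⟩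
      have h1 : sSup (S r t) ≤ ε / 2 := by
        apply csSup_le (hSne r t)
        rintro z (h | ⟨T, hT, s, q, hs, hr, hsq, hq, hqf, h⟩)
        · rw [h]; positivity
        · rw [h]
          exact hτ T hT.2 s q hs (hr.trans (le_max_left _ _)) hsq (by linarith) hqf
      have h2 : 0 ≤ sSup (S r t) := le_csSup (hSb r t) (Or.inl rfl)
      rw [Real.dist_eq, sub_zero, abs_of_nonneg h2]
      linarith
  · obtain ⟨β, hβ, hgβ⟩ := hkl
    refine ⟨β, hβ, ?_⟩
    intro T hT s hs t hst ht
    refine le_trans ?_ (hgβ _ _ (norm_nonneg _))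
    apply le_csSup (hSb _ _)
    exact Or.inr ⟨T, hT, s, t, hs, le_rfl, hst, by linarith, ht, rfl⟩
end
end
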